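/- arXiv:2602.19999 — 2 statements merged into one kernel-verified Lean document; each statement's English description precedes it below -/
import Mathlib

section
/- Let n ≥ 2, q ≥ 0 and p ∈ ℝ. Then there exists a constant C = C(n,p,q) > 0 such that for every x₀ ∈ ℝ^n, every R > 0 and every positive classical solution u of Δu + |∇u|^q u^p = 0 on the ball B(x₀, 2R) ⊂ ℝ^n, one has sup_{B(x₀,R)} |∇u|²/u² ≤ C ( sup_{B(x₀,2R)} u^{p−1}|∇u|^q + 1/R² ). -/
open scoped BigOperators

/-- The Euclidean Laplacian of `u : ℝⁿ → ℝ`, defined as the sum of the second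
partial derivatives in the coordinate directions. -/
noncomputable def elaplacian {n : ℕ} (u : EuclideanSpace ℝ (Fin n) → ℝ)
    (x : EuclideanSpace ℝ (Fin n)) : ℝ :=
  ∑ i : Fin n, fderiv ℝ (fun y => fderiv ℝ u y (EuclideanSpace.single i 1)) x
    (EuclideanSpace.single i 1)

open Set Filter Topology

lemma second_deriv_nonpos_of_isLocalMax {f f' : ℝ → ℝ} {c : ℝ} (hmax : IsLocalMax f 0)
    (hf : ∀ᶠ t in 𝓝 0, HasDerivAt f (f' t) t) (hf' : HasDerivAt f' c 0) :
    f' 0 = 0 ∧ c ≤ 0 := by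
  have h0 : f' 0 = 0 := hmax.hasDerivAt_eq_zero hf.self_of_nhds
  refine ⟨h0, ?_⟩
  by_contra! hc
  have hd : deriv f =ᶠ[𝓝 0] f' := hf.mono fun t ht => ht.deriv
  have hmin : IsLocalMin f 0 := by
    refine isLocalMin_of_deriv_deriv_pos ?_ ?_ hf.self_of_nhds.continuousAt
    · rwa [hd.deriv_eq, hf'.deriv]
    · rw [hd.self_of_nhds, h0]
  have hconst : f =ᶠ[𝓝 0] fun _ => f 0 := by
    filter_upwards [hmax, hmin] with t h1 h2 using le_antisymm h1 h2
  have hz : f' =ᶠ[𝓝 0] fun _ => 0 := by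
    refine hd.symm.trans (hconst.deriv.trans ?_)
    simp
  have : c = 0 := hf'.unique ((hasDerivAt_const 0 (0 : ℝ)).congr_of_eventuallyEq hz)
  exact hc.ne' this

section Line

variable {E : Type*} [NormedAddCommGroup E] [InnerProductSpace ℝ E]

lemma hasDerivAt_line (x v : E) (t : ℝ) : HasDerivAt (fun t : ℝ => x + t • v) v t := by
  simpa using ((hasDerivAt_id t).smul_const v).const_add x

lemma eventually_line_mem {s : Set E} (hs : IsOpen s) {x : E} (hx : x ∈ s) (v : E) :
    ∀ᶠ t : ℝ in 𝓝 0, x + t • v ∈ s :=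
  (hasDerivAt_line x v 0).continuousAt.eventually_mem (hs.mem_nhds (by simpa using hx))

lemma eventually_hasDerivAt_comp_line {w : E → ℝ} {s : Set E} (hs : IsOpen s)
    (hw : ContDiffOn ℝ 2 w s) {x : E} (hx : x ∈ s) (v : E) :
    ∀ᶠ t : ℝ in 𝓝 0,
      HasDerivAt (fun t : ℝ => w (x + t • v)) (fderiv ℝ w (x + t • v) v) t := by
  filter_upwards [eventually_line_mem hs hx v] with t ht
  exact ((hw.contDiffAt (hs.mem_nhds ht)).differentiableAt (by norm_num)).hasFDerivAt.comp_hasDerivAt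
    t (hasDerivAt_line x v t)

lemma differentiableAt_fderiv_of_contDiffOn {u : E → ℝ} {s : Set E} (hs : IsOpen s)
    (hu : ContDiffOn ℝ 2 u s) {x : E} (hx : x ∈ s) : DifferentiableAt ℝ (fderiv ℝ u) x :=
  ((hu.contDiffAt (hs.mem_nhds hx)).fderiv_right (m := 1) (by norm_num)).differentiableAt
    (by norm_num)

lemma hasDerivAt_fderiv_line {w : E → ℝ} {s : Set E} (hs : IsOpen s)
    (hw : ContDiffOn ℝ 2 w s) {x : E} (hx : x ∈ s) (v : E) :
    HasDerivAt (fun t : ℝ => fderiv ℝ w (x + t • v) v) (fderiv ℝ (fderiv ℝ w) x v v) 0 := by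
  have h1 := differentiableAt_fderiv_of_contDiffOn hs hw hx
  have h2 : HasFDerivAt (fun y => fderiv ℝ w y v) ((fderiv ℝ (fderiv ℝ w) x).flip v)
      (x + (0 : ℝ) • v) := by
    rw [zero_smul, add_zero]
    exact (ContinuousLinearMap.apply ℝ ℝ v).hasFDerivAt.comp x h1.hasFDerivAt
  exact h2.comp_hasDerivAt 0 (hasDerivAt_line x v 0)

lemma hasDerivAt_inner_line (z v : E) (t : ℝ) :
    HasDerivAt (fun t : ℝ => inner ℝ (z + t • v) v) (‖v‖ ^ 2) t := by
  simpa using (hasDerivAt_line z v t).inner ℝ (hasDerivAt_const t v)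

lemma hasDerivAt_norm_sq_line (z v : E) (t : ℝ) :
    HasDerivAt (fun t : ℝ => ‖z + t • v‖ ^ 2) (2 * inner ℝ (z + t • v) v) t := by
  simpa using (hasDerivAt_line z v t).norm_sq

lemma hasDerivAt_norm_line {z v : E} {t : ℝ} (h : z + t • v ≠ 0) :
    HasDerivAt (fun t : ℝ => ‖z + t • v‖) (inner ℝ (z + t • v) v / ‖z + t • v‖) t := by
  have h1 := (hasDerivAt_norm_sq_line z v t).sqrt (by positivity)
  simp only [Real.sqrt_sq (norm_nonneg _)] at h1
  convert h1 using 1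
  field_simp

/-- First and second order conditions at a local maximum of
`w x - w y - φ(|x - y|) - κ |x - z|²`, where `φ' = g` and `g' = h`. -/
lemma conditions_of_isLocalMax_pair {w : E → ℝ} {s : Set E} (hs : IsOpen s)
    (hw : ContDiffOn ℝ 2 w s) {φ g : ℝ → ℝ} {h : ℝ} (κ : ℝ) {x y z : E} (hx : x ∈ s)
    (hy : y ∈ s) (hxy : x ≠ y) (hφ : ∀ r, HasDerivAt φ (g r) r)
    (hg : HasDerivAt g h ‖x - y‖)
    (hmax : IsLocalMax
      (fun a : E × E => w a.1 - w a.2 - φ ‖a.1 - a.2‖ - κ * ‖a.1 - z‖ ^ 2) (x, y))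
    (ξ η : E) :
    fderiv ℝ w x ξ - fderiv ℝ w y η - g ‖x - y‖ * (inner ℝ (x - y) (ξ - η) / ‖x - y‖)
        - κ * (2 * inner ℝ (x - z) ξ) = 0 ∧
      fderiv ℝ (fderiv ℝ w) x ξ ξ - fderiv ℝ (fderiv ℝ w) y η η
        - (h * (inner ℝ (x - y) (ξ - η) / ‖x - y‖) ^ 2 + g ‖x - y‖ *
          ((‖ξ - η‖ ^ 2 - (inner ℝ (x - y) (ξ - η) / ‖x - y‖) ^ 2) / ‖x - y‖))
        - κ * (2 * ‖ξ‖ ^ 2) ≤ 0 := by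
  have hd : (x - y) ≠ 0 := sub_ne_zero.2 hxy
  have hev : ∀ᶠ t : ℝ in 𝓝 0, (x - y) + t • (ξ - η) ≠ 0 :=
    eventually_line_mem (s := {0}ᶜ) isOpen_compl_singleton hd (ξ - η)
  set f : ℝ → ℝ := fun t => w (x + t • ξ) - w (y + t • η) - φ ‖(x - y) + t • (ξ - η)‖
    - κ * ‖(x - z) + t • ξ‖ ^ 2 with hf
  set f' : ℝ → ℝ := fun t => fderiv ℝ w (x + t • ξ) ξ - fderiv ℝ w (y + t • η) η
    - g ‖(x - y) + t • (ξ - η)‖ * (inner ℝ ((x - y) + t • (ξ - η)) (ξ - η)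
      / ‖(x - y) + t • (ξ - η)‖) - κ * (2 * inner ℝ ((x - z) + t • ξ) ξ) with hf'
  have h1 : IsLocalMax f 0 := by
    have hc : ContinuousAt (fun t : ℝ => (x + t • ξ, y + t • η)) 0 := by fun_prop
    have ht : Tendsto (fun t : ℝ => (x + t • ξ, y + t • η)) (𝓝 0) (𝓝 (x, y)) := by
      simpa [ContinuousAt] using hc
    filter_upwards [ht.eventually hmax] with t hmt
    have e1 : x + t • ξ - (y + t • η) = (x - y) + t • (ξ - η) := by module
    have e2 : x + t • ξ - z = (x - z) + t • ξ := by module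
    simp only [e1, e2] at hmt
    simpa [hf] using hmt
  have h2 : ∀ᶠ t in 𝓝 0, HasDerivAt f (f' t) t := by
    filter_upwards [hev, eventually_hasDerivAt_comp_line hs hw hx ξ,
      eventually_hasDerivAt_comp_line hs hw hy η] with t h0 ha hb
    exact ((ha.sub hb).sub ((hφ _).comp t (hasDerivAt_norm_line h0))).sub
      ((hasDerivAt_norm_sq_line (x - z) ξ t).const_mul κ)
  have h0 : (x - y) + (0 : ℝ) • (ξ - η) ≠ 0 := by simpa using hd
  have hn : ‖x - y‖ ≠ 0 := norm_ne_zero_iff.2 hd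
  have hg' : HasDerivAt g h ‖(x - y) + (0 : ℝ) • (ξ - η)‖ := by simpa using hg
  have h3 := (((hasDerivAt_fderiv_line hs hw hx ξ).sub (hasDerivAt_fderiv_line hs hw hy η)).sub
    ((hg'.comp 0 (hasDerivAt_norm_line h0)).mul
      ((hasDerivAt_inner_line (x - y) (ξ - η) 0).div (hasDerivAt_norm_line h0)
        (norm_ne_zero_iff.2 h0)))).sub
    (((hasDerivAt_inner_line (x - z) ξ 0).const_mul 2).const_mul κ)
  obtain ⟨k1, k2⟩ := second_deriv_nonpos_of_isLocalMax h1 h2 h3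
  refine ⟨by simpa [hf'] using k1, ?_⟩
  refine le_trans (le_of_eq ?_) k2
  simp only [zero_smul, add_zero, Function.comp, Pi.div_apply]
  field_simp

end Line

section Coordinates

variable {n : ℕ}

local notation "𝔼" => EuclideanSpace ℝ (Fin n)
local notation "𝐞" i:max => (EuclideanSpace.single i (1 : ℝ) : EuclideanSpace ℝ (Fin n))

lemma sum_coord_smul_single (z : 𝔼) : ∑ i, z i • 𝐞 i = z := by
  ext j
  simp [Finset.sum_apply, Pi.single_apply]

lemma sum_coord_sq (z : 𝔼) : ∑ i, z i ^ 2 = ‖z‖ ^ 2 := by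
  simp [EuclideanSpace.norm_sq_eq]

lemma inner_single_one (z : 𝔼) (i : Fin n) : inner ℝ z (𝐞 i) = z i := by
  simp [EuclideanSpace.inner_single_right]

lemma sum_clm_single_sq (L : 𝔼 →L[ℝ] ℝ) (v : 𝔼) (h : ∀ ξ, L ξ = inner ℝ v ξ) :
    ∑ i, L (𝐞 i) ^ 2 = ‖v‖ ^ 2 := by
  simp only [h, inner_single_one, sum_coord_sq]

/-- The trace of a bilinear form is unchanged by the reflection in `zᗮ`. -/
lemma sum_bilin_reflection (B : 𝔼 →L[ℝ] 𝔼 →L[ℝ] ℝ) {z : 𝔼} (hz : z ≠ 0) :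
    ∑ i, B (𝐞 i - (2 * z i / ‖z‖ ^ 2) • z) (𝐞 i - (2 * z i / ‖z‖ ^ 2) • z) =
      ∑ i, B (𝐞 i) (𝐞 i) := by
  have hn : ‖z‖ ≠ 0 := norm_ne_zero_iff.2 hz
  have h1 : ∑ i, z i * B (𝐞 i) z = B z z := by
    calc ∑ i, z i * B (𝐞 i) z = B.flip z (∑ i, z i • 𝐞 i) := by simp only [map_sum, map_smul,
          ContinuousLinearMap.flip_apply, smul_eq_mul]
      _ = B z z := by rw [sum_coord_smul_single, ContinuousLinearMap.flip_apply]
  have h2 : ∑ i, z i * B z (𝐞 i) = B z z := by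
    calc ∑ i, z i * B z (𝐞 i) = B z (∑ i, z i • 𝐞 i) := by simp only [map_sum, map_smul,
          smul_eq_mul]
      _ = B z z := by rw [sum_coord_smul_single]
  have h3 : ∀ i, B (𝐞 i - (2 * z i / ‖z‖ ^ 2) • z) (𝐞 i - (2 * z i / ‖z‖ ^ 2) • z) =
      B (𝐞 i) (𝐞 i) - (2 / ‖z‖ ^ 2) * (z i * B (𝐞 i) z) - (2 / ‖z‖ ^ 2) * (z i * B z (𝐞 i))
        + (4 / ‖z‖ ^ 4 * B z z) * z i ^ 2 := by
    intro i
    simp only [map_sub, map_smul, sub_apply, smul_apply,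
      smul_eq_mul]
    field_simp
    ring
  simp only [h3, Finset.sum_add_distrib, Finset.sum_sub_distrib, ← Finset.mul_sum, h1, h2,
    sum_coord_sq]
  field_simp
  ring

lemma gradient_conditions_of_isLocalMax_pair {w : 𝔼 → ℝ} {s : Set 𝔼} (hs : IsOpen s)
    (hw : ContDiffOn ℝ 2 w s) {φ g : ℝ → ℝ} {h : ℝ} (κ : ℝ) {x y z : 𝔼} (hx : x ∈ s)
    (hy : y ∈ s) (hxy : x ≠ y) (hφ : ∀ r, HasDerivAt φ (g r) r)
    (hg : HasDerivAt g h ‖x - y‖)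
    (hmax : IsLocalMax
      (fun a : 𝔼 × 𝔼 => w a.1 - w a.2 - φ ‖a.1 - a.2‖ - κ * ‖a.1 - z‖ ^ 2) (x, y)) :
    ∑ i, fderiv ℝ w y (𝐞 i) ^ 2 = g ‖x - y‖ ^ 2 ∧
      ∑ i, fderiv ℝ w x (𝐞 i) ^ 2 ≤ (|g ‖x - y‖| + 2 * |κ| * ‖x - z‖) ^ 2 := by
  have hc := conditions_of_isLocalMax_pair hs hw κ hx hy hxy hφ hg hmax
  have hn : ‖x - y‖ ≠ 0 := norm_ne_zero_iff.2 (sub_ne_zero.2 hxy)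
  have hv : ‖(g ‖x - y‖ / ‖x - y‖) • (x - y)‖ = |g ‖x - y‖| := by
    rw [norm_smul, Real.norm_eq_abs, abs_div, abs_norm, div_mul_cancel₀ _ hn]
  constructor
  · rw [sum_clm_single_sq _ ((g ‖x - y‖ / ‖x - y‖) • (x - y)), hv, sq_abs]
    intro η
    have := (hc 0 η).1
    simp only [map_zero, zero_sub, inner_neg_right, inner_zero_right] at this
    rw [real_inner_smul_left]
    linear_combination -this
  · rw [sum_clm_single_sq _ ((g ‖x - y‖ / ‖x - y‖) • (x - y) + (2 * κ) • (x - z))]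
    · gcongr
      refine (norm_add_le _ _).trans (le_of_eq ?_)
      rw [hv, norm_smul, Real.norm_eq_abs, abs_mul, abs_two]
    · intro ξ
      have := (hc ξ 0).1
      simp only [map_zero, sub_zero] at this
      rw [inner_add_left, real_inner_smul_left, real_inner_smul_left]
      linear_combination this

lemma laplacian_condition_of_isLocalMax_pair {w : 𝔼 → ℝ} {s : Set 𝔼} (hs : IsOpen s)
    (hw : ContDiffOn ℝ 2 w s) {φ g : ℝ → ℝ} {h : ℝ} (κ : ℝ) {x y z : 𝔼} (hx : x ∈ s)
    (hy : y ∈ s) (hxy : x ≠ y) (hφ : ∀ r, HasDerivAt φ (g r) r)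
    (hg : HasDerivAt g h ‖x - y‖)
    (hmax : IsLocalMax
      (fun a : 𝔼 × 𝔼 => w a.1 - w a.2 - φ ‖a.1 - a.2‖ - κ * ‖a.1 - z‖ ^ 2) (x, y))
    (b : ℝ) :
    ∑ i, fderiv ℝ (fderiv ℝ w) x (𝐞 i) (𝐞 i)
        - b ^ 2 * ∑ i, fderiv ℝ (fderiv ℝ w) y (𝐞 i) (𝐞 i) ≤
      (1 + b) ^ 2 * h + (b - 1) ^ 2 * (n - 1) * (g ‖x - y‖ / ‖x - y‖) + 2 * κ * n := by
  have hd : x - y ≠ 0 := sub_ne_zero.2 hxy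
  have hn : ‖x - y‖ ≠ 0 := norm_ne_zero_iff.2 hd
  rw [← sum_bilin_reflection (fderiv ℝ (fderiv ℝ w) y) hd]
  set v := x - y with hv
  have hi : ∀ i, inner ℝ v (𝐞 i - b • (𝐞 i - (2 * v i / ‖v‖ ^ 2) • v)) = (1 + b) * v i := by
    intro i
    simp only [inner_sub_right, real_inner_smul_right, inner_single_one,
      real_inner_self_eq_norm_sq]
    field_simp
    ring
  have hnorm : ∀ i, ‖𝐞 i - b • (𝐞 i - (2 * v i / ‖v‖ ^ 2) • v)‖ ^ 2 =
      (b - 1) ^ 2 + 4 * b * (v i ^ 2 / ‖v‖ ^ 2) := by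
    intro i
    have h1 : inner ℝ (𝐞 i) v = v i := by rw [real_inner_comm, inner_single_one]
    have h2 : ‖𝐞 i‖ = 1 := by simp
    simp only [norm_sub_sq_real, norm_smul, mul_pow, real_inner_smul_right, inner_sub_right, h1,
      h2, real_inner_self_eq_norm_sq, Real.norm_eq_abs, sq_abs]
    field_simp
    ring
  have key : ∀ i, fderiv ℝ (fderiv ℝ w) x (𝐞 i) (𝐞 i)
      - b ^ 2 * fderiv ℝ (fderiv ℝ w) y (𝐞 i - (2 * v i / ‖v‖ ^ 2) • v)
        (𝐞 i - (2 * v i / ‖v‖ ^ 2) • v) ≤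
      ((1 + b) ^ 2 * h / ‖v‖ ^ 2 - g ‖v‖ * (b - 1) ^ 2 / ‖v‖ ^ 3) * v i ^ 2
        + ((b - 1) ^ 2 * (g ‖v‖ / ‖v‖) + 2 * κ) := by
    intro i
    have h2 := (conditions_of_isLocalMax_pair hs hw κ hx hy hxy hφ hg hmax (𝐞 i)
      (b • (𝐞 i - (2 * v i / ‖v‖ ^ 2) • v))).2
    rw [← hv, hi, hnorm] at h2
    have h3 : ‖𝐞 i‖ = 1 := by simp
    rw [h3] at h2
    simp only [map_smul, smul_apply, smul_eq_mul] at h2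
    have h4 : h * ((1 + b) * v i / ‖v‖) ^ 2 + g ‖v‖ *
          (((b - 1) ^ 2 + 4 * b * (v i ^ 2 / ‖v‖ ^ 2) - ((1 + b) * v i / ‖v‖) ^ 2) / ‖v‖)
        = ((1 + b) ^ 2 * h / ‖v‖ ^ 2 - g ‖v‖ * (b - 1) ^ 2 / ‖v‖ ^ 3) * v i ^ 2
        + (b - 1) ^ 2 * (g ‖v‖ / ‖v‖) := by
      field_simp
      ring
    rw [h4] at h2
    linarith
  rw [Finset.mul_sum, ← Finset.sum_sub_distrib]
  refine (Finset.sum_le_sum fun i _ => key i).trans (le_of_eq ?_)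
  rw [Finset.sum_add_distrib, ← Finset.mul_sum, sum_coord_sq]
  simp only [Finset.sum_const, Finset.card_univ, Fintype.card_fin, nsmul_eq_mul]
  field_simp
  ring

lemma profile_inequality {m η s γ : ℝ} (hm : 1 ≤ m) (hη : η = 1 / (1000 * m)) (hs : 0 < s)
    (hs1 : s < 1) (hγ : γ = 1 - η - 2 * η * s + 9 * η * s ^ 2) :
    (γ + 4 * η / 10) ^ 2 + η + ((1 + (1 + s / (2 * m))) ^ 2 * (η * (-2 + 18 * s))
      + (s / (2 * m)) ^ 2 * (m - 1) * (γ / s) + 4 * m * (η / 10) ^ 2)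
      < (1 + s / (2 * m)) ^ 2 * γ ^ 2 := by
  have hm0 : 0 < m := by linarith
  have hη0 : 0 < η := by rw [hη]; positivity
  have hmη : m * η = 1 / 1000 := by rw [hη]; field_simp
  have hη1 : η ≤ 1 / 1000 := by nlinarith
  obtain ⟨ν, hν⟩ : ∃ ν, ν = 1 / m := ⟨_, rfl⟩
  have hν0 : 0 < ν := by rw [hν]; positivity
  have hνη : ν = 1000 * η := by rw [hν, hη]; field_simp
  have hmν : m * ν = 1 := by rw [hν]; field_simp
  have hν1 : ν ≤ 1 := by linarith
  have hss : s ^ 2 < s := by nlinarith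
  have hγ1 : 1 / 2 ≤ γ := by rw [hγ]; nlinarith [mul_pos hη0 hs, mul_pos hη0 (pow_pos hs 2)]
  have hγ2 : γ ≤ 2 := by rw [hγ]; nlinarith [mul_pos hη0 hs, mul_pos hη0 (pow_pos hs 2)]
  have e1 : s / (2 * m) = s * ν / 2 := by rw [hν]; field_simp
  have e2 : (s / (2 * m)) ^ 2 * (m - 1) * (γ / s) = (s * ν * γ / 4) * (1 - ν) := by
    rw [hν]; field_simp; ring
  rw [e2, e1]
  have hsν : 0 < s * ν := mul_pos hs hν0
  have hsν1 : s * ν ≤ 1 := by nlinarith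
  have e3 : (s * ν * γ / 4) * (1 - ν) ≤ s * ν * γ / 4 := by
    have : 0 ≤ s * ν * γ / 4 := by positivity
    nlinarith
  have e4 : (1 + (1 + s * ν / 2)) ^ 2 * (η * (-2 + 18 * s)) ≤ -8 * η + 18 * 7 * (η * s) := by
    have h1 : 4 ≤ (1 + (1 + s * ν / 2)) ^ 2 := by nlinarith
    have h2 : (1 + (1 + s * ν / 2)) ^ 2 ≤ 7 := by nlinarith
    have hηs : 0 < η * s := mul_pos hη0 hs
    calc (1 + (1 + s * ν / 2)) ^ 2 * (η * (-2 + 18 * s))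
        = -2 * (η * (1 + (1 + s * ν / 2)) ^ 2) + 18 * ((1 + (1 + s * ν / 2)) ^ 2 * (η * s)) := by
          ring
      _ ≤ -2 * (η * 4) + 18 * (7 * (η * s)) := by gcongr ?_ + _ * (?_ * _); nlinarith
      _ = _ := by ring
  have e5 : 4 * m * (η / 10) ^ 2 ≤ η / 1000 := by
    have : 4 * m * (η / 10) ^ 2 = 4 / 100 * (m * η) * η := by ring
    rw [this, hmη]; linarith
  have e6 : s * ν * γ / 4 + s * ν / 8 ≤ ((1 + s * ν / 2) ^ 2 - 1) * γ ^ 2 := by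
    have h1 : s * ν ≤ (1 + s * ν / 2) ^ 2 - 1 := by nlinarith [sq_nonneg (s * ν)]
    have h2 : γ / 4 + 1 / 8 ≤ γ ^ 2 := by nlinarith
    calc s * ν * γ / 4 + s * ν / 8 = s * ν * (γ / 4 + 1 / 8) := by ring
      _ ≤ s * ν * γ ^ 2 := by gcongr
      _ ≤ _ := by gcongr
  have e7 : (γ + 4 * η / 10) ^ 2 ≤ γ ^ 2 + 2 * η := by nlinarith
  have e8 : 18 * 7 * (η * s) ≤ s * ν / 8 + η := by
    have : η * s ≤ η * 1 := by gcongr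
    rw [hνη]; linarith
  linarith

lemma exists_unit_apply_eq_norm (L : 𝔼 →L[ℝ] ℝ) (hL : 0 < ‖L‖) :
    ∃ v : 𝔼, ‖v‖ = 1 ∧ L v = ‖L‖ := by
  set a := (InnerProductSpace.toDual ℝ 𝔼).symm L with ha
  have hn : ‖a‖ = ‖L‖ := by simp [ha]
  refine ⟨‖a‖⁻¹ • a, ?_, ?_⟩
  · rw [norm_smul, norm_inv, norm_norm, inv_mul_cancel₀ (by rw [hn]; exact hL.ne')]
  · have : L a = ‖a‖ ^ 2 := by
      rw [← real_inner_self_eq_norm_sq]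
      exact (InnerProductSpace.toDual_symm_apply (y := L)).symm
    rw [map_smul, this, smul_eq_mul, ← hn]
    have : ‖a‖ ≠ 0 := by rw [hn]; exact hL.ne'
    field_simp

lemma sum_clm_single_sq_eq_norm_sq (L : 𝔼 →L[ℝ] ℝ) : ∑ i, L (𝐞 i) ^ 2 = ‖L‖ ^ 2 := by
  rw [sum_clm_single_sq L ((InnerProductSpace.toDual ℝ 𝔼).symm L)]
  · simp
  · intro ξ; simp [InnerProductSpace.toDual_symm_apply]

/-- The comparison profile. -/
noncomputable def profile (η L r : ℝ) : ℝ :=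
  (1 - η) * (L * r) - η * (L * r) ^ 2 + 3 * η * (L * r) ^ 3

/-- The derivative of the comparison profile. -/
noncomputable def profileDeriv (η L r : ℝ) : ℝ :=
  L * (1 - η - 2 * η * (L * r) + 9 * η * (L * r) ^ 2)

lemma hasDerivAt_profile (η L r : ℝ) :
    HasDerivAt (profile η L) (profileDeriv η L r) r := by
  have h : HasDerivAt (fun r => L * r) L r := by simpa using (hasDerivAt_id r).const_mul L
  refine (((h.const_mul (1 - η)).sub ((h.pow 2).const_mul η)).add
    ((h.pow 3).const_mul (3 * η))).congr_deriv ?_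
  simp only [profileDeriv]
  push_cast
  ring

lemma hasDerivAt_profileDeriv (η L r : ℝ) :
    HasDerivAt (profileDeriv η L) (L ^ 2 * (η * (-2 + 18 * (L * r)))) r := by
  have h : HasDerivAt (fun r => L * r) L r := by simpa using (hasDerivAt_id r).const_mul L
  refine ((((hasDerivAt_const r (1 - η)).sub (h.const_mul (2 * η))).add
    ((h.pow 2).const_mul (9 * η))).const_mul L).congr_deriv ?_
  push_cast
  ring

lemma exists_profile_lt {w : 𝔼 → ℝ} {z : 𝔼} {η L : ℝ} (hη : 0 < η) (hL : 0 < L)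
    (hw : DifferentiableAt ℝ w z) (hgrad : ‖fderiv ℝ w z‖ = L) :
    ∃ y, ‖z - y‖ ≤ 1 / L ∧ profile η L ‖z - y‖ < w z - w y := by
  obtain ⟨v, hv, hLv⟩ := exists_unit_apply_eq_norm (fderiv ℝ w z) (hgrad ▸ hL)
  have hd : HasDerivAt (fun t : ℝ => w z - w (z + t • (-v)) - profile η L t) (η * L) 0 := by
    have h1 : HasFDerivAt w (fderiv ℝ w z) (z + (0 : ℝ) • (-v)) := by
      simpa using hw.hasFDerivAt
    refine (((h1.comp_hasDerivAt 0 (hasDerivAt_line z (-v) 0)).const_sub (w z)).sub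
      (hasDerivAt_profile η L 0)).congr_deriv ?_
    simp [hLv, hgrad, profileDeriv]
    ring
  have hs := (hasDerivAt_iff_tendsto_slope_zero.1 hd).eventually
    (lt_mem_nhds (show 0 < η * L by positivity))
  have hs' : ∀ᶠ t : ℝ in 𝓝[>] 0, 0 < t⁻¹ • ((fun t : ℝ => w z - w (z + t • (-v))
      - profile η L t) (0 + t) - (fun t : ℝ => w z - w (z + t • (-v)) - profile η L t) 0) :=
    hs.filter_mono (nhdsWithin_mono _ fun t ht => ne_of_gt ht)
  have hsmall : ∀ᶠ t : ℝ in 𝓝[>] 0, t < 1 / L :=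
    nhdsWithin_le_nhds (eventually_lt_nhds (show 0 < 1 / L by positivity))
  obtain ⟨t, ht, htL, ht0⟩ := (hs'.and (hsmall.and self_mem_nhdsWithin)).exists
  have ht0 : 0 < t := ht0
  have hnorm : ‖z - (z + t • (-v))‖ = t := by
    rw [show z - (z + t • (-v)) = t • v by module, norm_smul, hv, mul_one, Real.norm_eq_abs,
      abs_of_pos ht0]
  refine ⟨z + t • (-v), by rw [hnorm]; exact htL.le, ?_⟩
  rw [hnorm]
  simp only [zero_add, zero_smul, add_zero, sub_self, smul_eq_mul] at ht
  have h0 : profile η L 0 = 0 := by simp [profile]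
  rw [h0] at ht
  have := (mul_pos_iff_of_pos_left (inv_pos.2 ht0)).1 ht
  linarith

/-- The function compared with the profile has an interior maximum off the diagonal. -/
lemma exists_isLocalMax_pair {w : 𝔼 → ℝ} {s : Set 𝔼} (hs : IsOpen s)
    (hw : ContDiffOn ℝ 2 w s) {η L k : ℝ} {z : 𝔼} (hη0 : 0 < η) (hη1 : η ≤ 1 / 1000)
    (hL : 0 < L) (hk0 : 0 < k) (hball : Metric.closedBall z ((k + 1) / L) ⊆ s)
    (hgrad : ‖fderiv ℝ w z‖ = L)
    (hgrad_le : ∀ x ∈ Metric.closedBall z ((k + 1) / L), ‖fderiv ℝ w x‖ ≤ (1 + η) * L) :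
    ∃ x ∈ s, ∃ y ∈ s, x ≠ y ∧ ‖x - z‖ < k / L ∧ ‖x - y‖ < 1 / L ∧
      IsLocalMax (fun a : 𝔼 × 𝔼 => w a.1 - w a.2 - profile η L ‖a.1 - a.2‖
        - 2 * (L / k) ^ 2 * ‖a.1 - z‖ ^ 2) (x, y) := by
  have hkL : k / L + 1 / L = (k + 1) / L := by ring
  set κ : ℝ := 2 * (L / k) ^ 2 with hκ
  have hκ0 : 0 < κ := by positivity
  set B := Metric.closedBall z ((k + 1) / L) with hB
  have hlip : ∀ x ∈ B, ∀ y ∈ B, w x - w y ≤ (1 + η) * (L * ‖x - y‖) := by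
    intro x hx y hy
    have := (convex_closedBall z ((k + 1) / L)).norm_image_sub_le_of_norm_fderiv_le
      (fun a ha => (hw.contDiffAt (hs.mem_nhds (hball ha))).differentiableAt (by norm_num))
      hgrad_le hy hx
    rw [← mul_assoc]
    exact (le_abs_self _).trans this
  set K : Set (𝔼 × 𝔼) := {a | ‖a.1 - z‖ ≤ k / L ∧ ‖a.1 - a.2‖ ≤ 1 / L} with hK
  have hK1 : ∀ a ∈ K, a.1 ∈ B := by
    rintro a ⟨h1, -⟩
    rw [hB, mem_closedBall_iff_norm, ← hkL]
    have : 0 < 1 / L := by positivity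
    linarith
  have hK2 : ∀ a ∈ K, a.2 ∈ B := by
    rintro a ⟨h1, h2⟩
    rw [hB, mem_closedBall_iff_norm, ← hkL]
    calc ‖a.2 - z‖ = ‖(a.1 - z) - (a.1 - a.2)‖ := by congr 1; abel
      _ ≤ ‖a.1 - z‖ + ‖a.1 - a.2‖ := norm_sub_le _ _
      _ ≤ _ := add_le_add h1 h2
  have hc1 : Continuous fun a : 𝔼 × 𝔼 => ‖a.1 - z‖ := by fun_prop
  have hc2 : Continuous fun a : 𝔼 × 𝔼 => ‖a.1 - a.2‖ := by fun_prop
  have hKclosed : IsClosed K :=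
    (isClosed_le hc1 continuous_const).inter (isClosed_le hc2 continuous_const)
  have hKcpt : IsCompact K :=
    ((isCompact_closedBall z ((k + 1) / L)).prod
      (isCompact_closedBall z ((k + 1) / L))).of_isClosed_subset hKclosed
      fun a ha => ⟨hK1 a ha, hK2 a ha⟩
  set Φ : 𝔼 × 𝔼 → ℝ :=
    fun a => w a.1 - w a.2 - profile η L ‖a.1 - a.2‖ - κ * ‖a.1 - z‖ ^ 2 with hΦ
  have hφc : Continuous (profile η L) :=
    continuous_iff_continuousAt.2 fun r => (hasDerivAt_profile η L r).continuousAt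
  have hΦc : ContinuousOn Φ K := by
    have h1 : ContinuousOn (fun a : 𝔼 × 𝔼 => w a.1) K :=
      hw.continuousOn.comp continuousOn_fst fun a ha => hball (hK1 a ha)
    have h2 : ContinuousOn (fun a : 𝔼 × 𝔼 => w a.2) K :=
      hw.continuousOn.comp continuousOn_snd fun a ha => hball (hK2 a ha)
    refine ((h1.sub h2).sub ?_).sub ?_
    · exact (hφc.comp (by fun_prop)).continuousOn
    · exact Continuous.continuousOn (by fun_prop)
  have hzs : z ∈ s := hball (Metric.mem_closedBall_self (by positivity))
  obtain ⟨y₀, hy₀, hlt⟩ := exists_profile_lt hη0 hL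
    ((hw.contDiffAt (hs.mem_nhds hzs)).differentiableAt (by norm_num)) hgrad
  have hmem : (z, y₀) ∈ K := ⟨by simp; positivity, hy₀⟩
  obtain ⟨⟨x, y⟩, hxyK, hmax⟩ := hKcpt.exists_isMaxOn ⟨_, hmem⟩ hΦc
  have hpos : 0 < w x - w y - profile η L ‖x - y‖ - κ * ‖x - z‖ ^ 2 := by
    have h1 : Φ (z, y₀) ≤ Φ (x, y) := hmax hmem
    have h2 : 0 < Φ (z, y₀) := by simp only [hΦ, sub_self, norm_zero]; linarith
    exact h2.trans_le h1
  have hxB := hK1 _ hxyK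
  have hyB := hK2 _ hxyK
  have hl := hlip x hxB y hyB
  obtain ⟨hxz, hd⟩ := hxyK
  simp only at hxB hyB hxz hd
  have hxy : x ≠ y := by
    rintro rfl
    simp only [sub_self, norm_zero, profile] at hpos
    nlinarith [sq_nonneg ‖x - z‖]
  have hd0 : 0 < ‖x - y‖ := norm_pos_iff.2 (sub_ne_zero.2 hxy)
  obtain ⟨t, ht⟩ : ∃ t, t = L * ‖x - y‖ := ⟨_, rfl⟩
  have ht0 : 0 < t := by rw [ht]; positivity
  have ht1 : t ≤ 1 := by
    rw [ht]; calc _ ≤ L * (1 / L) := by gcongr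
      _ = 1 := by field_simp
  have hd' : ‖x - y‖ < 1 / L := by
    refine lt_of_le_of_ne hd fun h => ?_
    have : L * ‖x - y‖ = 1 := by rw [h]; field_simp
    rw [this] at hl
    simp only [profile, this] at hpos
    nlinarith [mul_nonneg hκ0.le (sq_nonneg ‖x - z‖)]
  have hxz' : ‖x - z‖ < k / L := by
    refine lt_of_le_of_ne hxz fun h => ?_
    have h2 : κ * ‖x - z‖ ^ 2 = 2 := by rw [h, hκ]; field_simp
    rw [h2] at hpos
    simp only [profile, ← ht] at hpos hl
    nlinarith [mul_pos hη0 ht0, mul_pos hη0 (pow_pos ht0 3)]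
  have hKnhds : K ∈ 𝓝 (x, y) := by
    have hopen : IsOpen {a : 𝔼 × 𝔼 | ‖a.1 - z‖ < k / L ∧ ‖a.1 - a.2‖ < 1 / L} :=
      (isOpen_lt hc1 continuous_const).inter (isOpen_lt hc2 continuous_const)
    exact mem_of_superset (hopen.mem_nhds ⟨hxz', hd'⟩) fun a ha => ⟨ha.1.le, ha.2.le⟩
  exact ⟨x, hball hxB, y, hball hyB, hxy, hxz', hd', hmax.isLocalMax hKnhds⟩

/-- A solution of `Δw + |∇w|² + V = 0` with `0 ≤ V ≤ M` small cannot have a gradient which is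
almost maximal on a large ball, measured in the scale given by the gradient. -/
lemma sq_lt_of_gradient_almost_max (hn : 1 ≤ n) {w : 𝔼 → ℝ} {s : Set 𝔼} (hs : IsOpen s)
    (hw : ContDiffOn ℝ 2 w s) {η L k M : ℝ} {z : 𝔼} (hη : η = 1 / (1000 * n)) (hL : 0 < L)
    (hk : k = 10 / η) (hball : Metric.closedBall z ((k + 1) / L) ⊆ s)
    (hgrad : ‖fderiv ℝ w z‖ = L)
    (hgrad_le : ∀ x ∈ Metric.closedBall z ((k + 1) / L), ‖fderiv ℝ w x‖ ≤ (1 + η) * L)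
    {V : 𝔼 → ℝ} (hV0 : ∀ x ∈ s, 0 ≤ V x) (hVM : ∀ x ∈ s, V x ≤ M)
    (heq : ∀ x ∈ s, ∑ i, fderiv ℝ (fderiv ℝ w) x (𝐞 i) (𝐞 i) =
      -∑ i, fderiv ℝ w x (𝐞 i) ^ 2 - V x) :
    η * L ^ 2 < M := by
  by_contra! hM
  have hn' : (1 : ℝ) ≤ n := by exact_mod_cast hn
  have hη0 : 0 < η := by rw [hη]; positivity
  have hη1 : η ≤ 1 / 1000 := by
    rw [hη]; gcongr; linarith
  have hk0 : 0 < k := by rw [hk]; positivity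
  obtain ⟨x, hxs, y, hys, hxy, hxz, hd, hloc⟩ :=
    exists_isLocalMax_pair hs hw hη0 hη1 hL hk0 hball hgrad hgrad_le
  set κ : ℝ := 2 * (L / k) ^ 2 with hκ
  have hκ0 : 0 < κ := by positivity
  have hd0 : 0 < ‖x - y‖ := norm_pos_iff.2 (sub_ne_zero.2 hxy)
  obtain ⟨t, ht⟩ : ∃ t, t = L * ‖x - y‖ := ⟨_, rfl⟩
  have ht0 : 0 < t := by rw [ht]; positivity
  have ht1 : t < 1 := by
    rw [ht]; calc _ < L * (1 / L) := by gcongr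
      _ = 1 := by field_simp
  obtain ⟨hgy, hgx⟩ := gradient_conditions_of_isLocalMax_pair hs hw κ hxs hys hxy
    (hasDerivAt_profile η L) (hasDerivAt_profileDeriv η L _) hloc
  have hlap := laplacian_condition_of_isLocalMax_pair hs hw κ hxs hys hxy
    (hasDerivAt_profile η L) (hasDerivAt_profileDeriv η L _) hloc (1 + t / (2 * n))
  rw [heq x hxs, heq y hys, hgy] at hlap
  obtain ⟨γ, hγ⟩ : ∃ γ, γ = 1 - η - 2 * η * t + 9 * η * t ^ 2 := ⟨_, rfl⟩
  have hG : profileDeriv η L ‖x - y‖ = L * γ := by rw [profileDeriv, hγ, ht]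
  have hγ0 : 0 ≤ γ := by rw [hγ]; nlinarith [mul_pos hη0 (pow_pos ht0 2)]
  have hdt : ‖x - y‖ = t / L := by rw [ht]; field_simp
  have hgx' : ∑ i, fderiv ℝ w x (𝐞 i) ^ 2 ≤ L ^ 2 * (γ + 4 * η / 10) ^ 2 := by
    refine hgx.trans ?_
    rw [← mul_pow, hG, abs_of_nonneg (by positivity), abs_of_pos hκ0]
    gcongr
    calc L * γ + 2 * κ * ‖x - z‖ ≤ L * γ + 2 * κ * (k / L) := by gcongr
      _ = L * (γ + 4 * η / 10) := by rw [hκ, hk]; field_simp; ring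
  have hstrict := profile_inequality hn' hη ht0 ht1 hγ
  have hVx := hVM x hxs
  have hVy := hV0 y hys
  have hb : 0 ≤ (1 + t / (2 * n)) ^ 2 * V y := by positivity
  rw [hG, ← ht, hdt] at hlap
  have hfin := mul_lt_mul_of_pos_left hstrict (pow_pos hL 2)
  have e1 : L * γ / (t / L) = L ^ 2 * (γ / t) := by field_simp
  have e2 : 2 * κ * n = L ^ 2 * (4 * n * (η / 10) ^ 2) := by
    rw [hκ, hk]; field_simp; ring
  rw [e1, e2] at hlap
  linarith

/-- Gradient bound for `Δw + |∇w|² + V = 0` with `0 ≤ V ≤ M`. -/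
lemma norm_fderiv_sq_le (hn : 1 ≤ n) {η N : ℝ} (hη : η = 1 / (1000 * n))
    (hN : N = (10 / η + 1) / (η / 2)) {x₀ : 𝔼} {R M : ℝ} (hR : 0 < R) {w V : 𝔼 → ℝ}
    (hw : ContDiffOn ℝ 2 w (Metric.ball x₀ (2 * R)))
    (hV0 : ∀ x ∈ Metric.ball x₀ (2 * R), 0 ≤ V x)
    (hVM : ∀ x ∈ Metric.ball x₀ (2 * R), V x ≤ M)
    (heq : ∀ x ∈ Metric.ball x₀ (2 * R), ∑ i, fderiv ℝ (fderiv ℝ w) x (𝐞 i) (𝐞 i) =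
      -∑ i, fderiv ℝ w x (𝐞 i) ^ 2 - V x) {x : 𝔼} (hx : x ∈ Metric.ball x₀ R) :
    ‖fderiv ℝ w x‖ ^ 2 ≤ (4 * N ^ 2 + 9 / η) * (M + 1 / R ^ 2) := by
  have hn' : (1 : ℝ) ≤ n := by exact_mod_cast hn
  have hη0 : 0 < η := by rw [hη]; positivity
  have hη1 : η ≤ 1 / 1000 := by
    rw [hη]; gcongr; linarith
  have hN0 : 0 < N := by rw [hN]; positivity
  have hs : IsOpen (Metric.ball x₀ (2 * R)) := Metric.isOpen_ball
  have hsub : Metric.closedBall x₀ (3 / 2 * R) ⊆ Metric.ball x₀ (2 * R) :=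
    Metric.closedBall_subset_ball (by linarith)
  have hM0 : 0 ≤ M :=
    (hV0 x₀ (Metric.mem_ball_self (by positivity))).trans
      (hVM x₀ (Metric.mem_ball_self (by positivity)))
  have hcont : ContinuousOn (fun a => ‖fderiv ℝ w a‖ * (3 / 2 * R - ‖a - x₀‖))
      (Metric.closedBall x₀ (3 / 2 * R)) :=
    (((hw.continuousOn_fderiv_of_isOpen hs (by norm_num)).mono hsub).norm).mul
      (Continuous.continuousOn (by fun_prop))
  obtain ⟨z, hz, hmax⟩ := (isCompact_closedBall x₀ (3 / 2 * R)).exists_isMaxOn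
    ⟨x₀, Metric.mem_closedBall_self (by positivity)⟩ hcont
  obtain ⟨L, hL⟩ : ∃ L, ‖fderiv ℝ w z‖ = L := ⟨_, rfl⟩
  obtain ⟨ρ, hρ⟩ : ∃ ρ, 3 / 2 * R - ‖z - x₀‖ = ρ := ⟨_, rfl⟩
  have hmax' : ∀ a ∈ Metric.closedBall x₀ (3 / 2 * R),
      ‖fderiv ℝ w a‖ * (3 / 2 * R - ‖a - x₀‖) ≤ L * ρ := by
    intro a ha
    rw [← hL, ← hρ]
    exact hmax ha
  have hL0 : 0 ≤ L := hL ▸ norm_nonneg _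
  have hρ0 : 0 ≤ ρ := by rw [mem_closedBall_iff_norm] at hz; linarith
  have hρR : ρ ≤ 3 / 2 * R := by linarith [norm_nonneg (z - x₀)]
  have hxL : ‖fderiv ℝ w x‖ * (R / 2) ≤ L * ρ := by
    have hx' : ‖x - x₀‖ < R := mem_ball_iff_norm.1 hx
    refine le_trans ?_ (hmax' x (mem_closedBall_iff_norm.2 (by linarith)))
    gcongr
    linarith
  rcases lt_or_ge (L * ρ) N with hlt | hge
  · have h1 : ‖fderiv ℝ w x‖ ≤ 2 * N / R := by
      rw [le_div_iff₀ hR]; linarith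
    calc ‖fderiv ℝ w x‖ ^ 2 ≤ (2 * N / R) ^ 2 := by gcongr
      _ = 4 * N ^ 2 * (0 + 1 / R ^ 2) := by ring
      _ ≤ (4 * N ^ 2 + 9 / η) * (M + 1 / R ^ 2) := by
        gcongr
        exact le_add_of_nonneg_right (by positivity)
  · have hLpos : 0 < L := by
      refine lt_of_le_of_ne hL0 fun h => ?_
      rw [← h, zero_mul] at hge
      linarith
    have hrad : (10 / η + 1) / L ≤ η / 2 * ρ := by
      rw [hN, div_le_iff₀ (by positivity)] at hge
      rw [div_le_iff₀ hLpos]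
      linarith
    have hnear : ∀ a ∈ Metric.closedBall z ((10 / η + 1) / L),
        ρ * (1 - η / 2) ≤ 3 / 2 * R - ‖a - x₀‖ := by
      intro a ha
      have h1 := mem_closedBall_iff_norm.1 ha
      have h2 : ‖a - x₀‖ ≤ ‖a - z‖ + ‖z - x₀‖ := norm_sub_le_norm_sub_add_norm_sub _ _ _
      linarith
    have hρpos : 0 < ρ := by
      refine lt_of_le_of_ne hρ0 fun h => ?_
      rw [← h, mul_zero] at hge
      linarith
    have hin : Metric.closedBall z ((10 / η + 1) / L) ⊆ Metric.closedBall x₀ (3 / 2 * R) := by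
      intro a ha
      have h1 := hnear a ha
      have : 0 ≤ ρ * (1 - η / 2) := mul_nonneg hρ0 (by linarith)
      exact mem_closedBall_iff_norm.2 (by linarith)
    have hgl : ∀ a ∈ Metric.closedBall z ((10 / η + 1) / L),
        ‖fderiv ℝ w a‖ ≤ (1 + η) * L := by
      intro a ha
      have h1 : ‖fderiv ℝ w a‖ * (ρ * (1 - η / 2)) ≤ L * ρ :=
        (mul_le_mul_of_nonneg_left (hnear a ha) (norm_nonneg _)).trans (hmax' a (hin ha))
      have h2 : ‖fderiv ℝ w a‖ * (1 - η / 2) ≤ L := by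
        refine le_of_mul_le_mul_right ?_ hρpos
        linarith
      have h3 : 1 ≤ (1 - η / 2) * (1 + η) := by nlinarith
      calc ‖fderiv ℝ w a‖ ≤ ‖fderiv ℝ w a‖ * ((1 - η / 2) * (1 + η)) :=
            le_mul_of_one_le_right (norm_nonneg _) h3
        _ = (1 + η) * (‖fderiv ℝ w a‖ * (1 - η / 2)) := by ring
        _ ≤ (1 + η) * L := by gcongr
    have hLM : η * L ^ 2 < M := sq_lt_of_gradient_almost_max hn hs hw hη hLpos rfl
      (hin.trans hsub) hL hgl hV0 hVM heq
    have h1 : ‖fderiv ℝ w x‖ ≤ 3 * L := by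
      have : L * ρ ≤ L * (3 / 2 * R) := by gcongr
      refine le_of_mul_le_mul_right ?_ (half_pos hR)
      linarith
    calc ‖fderiv ℝ w x‖ ^ 2 ≤ (3 * L) ^ 2 := by gcongr
      _ = 9 / η * (η * L ^ 2 + 0) := by field_simp; ring
      _ ≤ (4 * N ^ 2 + 9 / η) * (M + 1 / R ^ 2) := by
        gcongr
        · exact le_add_of_nonneg_left (by positivity)
        · positivity

lemma norm_gradient_eq (u : 𝔼 → ℝ) (x : 𝔼) : ‖gradient u x‖ = ‖fderiv ℝ u x‖ := by
  simp [gradient]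

lemma elaplacian_eq_sum_fderiv_fderiv {u : 𝔼 → ℝ} {x : 𝔼}
    (hu : DifferentiableAt ℝ (fderiv ℝ u) x) :
    elaplacian u x = ∑ i, fderiv ℝ (fderiv ℝ u) x (𝐞 i) (𝐞 i) := by
  refine Finset.sum_congr rfl fun i _ => ?_
  have h : HasFDerivAt (fun y => fderiv ℝ u y (𝐞 i)) ((fderiv ℝ (fderiv ℝ u) x).flip (𝐞 i)) x :=
    (ContinuousLinearMap.apply ℝ ℝ (𝐞 i)).hasFDerivAt.comp x hu.hasFDerivAt
  rw [h.fderiv, ContinuousLinearMap.flip_apply]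

lemma fderiv_log_of_pos {u : 𝔼 → ℝ} {s : Set 𝔼} (hs : IsOpen s) (hu : ContDiffOn ℝ 2 u s)
    (hpos : ∀ x ∈ s, 0 < u x) {x : 𝔼} (hx : x ∈ s) :
    fderiv ℝ (fun y => Real.log (u y)) x = (u x)⁻¹ • fderiv ℝ u x :=
  (((hu.contDiffAt (hs.mem_nhds hx)).differentiableAt (by norm_num)).hasFDerivAt.log
    (hpos x hx).ne').fderiv

lemma fderiv_fderiv_log_of_pos {u : 𝔼 → ℝ} {s : Set 𝔼} (hs : IsOpen s)
    (hu : ContDiffOn ℝ 2 u s) (hpos : ∀ x ∈ s, 0 < u x) {x : 𝔼} (hx : x ∈ s) (v : 𝔼) :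
    fderiv ℝ (fderiv ℝ (fun y => Real.log (u y))) x v v =
      (u x)⁻¹ * fderiv ℝ (fderiv ℝ u) x v v - ((u x)⁻¹ * fderiv ℝ u x v) ^ 2 := by
  have hux : u x ≠ 0 := (hpos x hx).ne'
  have hev : fderiv ℝ (fun y => Real.log (u y)) =ᶠ[𝓝 x] fun y => (u y)⁻¹ • fderiv ℝ u y := by
    filter_upwards [hs.mem_nhds hx] with y hy using fderiv_log_of_pos hs hu hpos hy
  have h1 : HasFDerivAt u (fderiv ℝ u x) x :=
    ((hu.contDiffAt (hs.mem_nhds hx)).differentiableAt (by norm_num)).hasFDerivAt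
  have h2 : HasFDerivAt (fun y => (u y)⁻¹) (-(u x ^ 2)⁻¹ • fderiv ℝ u x) x :=
    (hasDerivAt_inv hux).comp_hasFDerivAt x h1
  have h3 := h2.smul (differentiableAt_fderiv_of_contDiffOn hs hu hx).hasFDerivAt
  rw [hev.fderiv_eq]
  erw [h3.fderiv]
  simp only [add_apply, smul_apply, ContinuousLinearMap.smulRight_apply, smul_eq_mul]
  field_simp
  ring

lemma sum_fderiv_fderiv_log {u : 𝔼 → ℝ} {s : Set 𝔼} (hs : IsOpen s)
    (hu : ContDiffOn ℝ 2 u s) (hpos : ∀ x ∈ s, 0 < u x) {x : 𝔼} (hx : x ∈ s) :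
    ∑ i, fderiv ℝ (fderiv ℝ (fun y => Real.log (u y))) x (𝐞 i) (𝐞 i) =
      -∑ i, fderiv ℝ (fun y => Real.log (u y)) x (𝐞 i) ^ 2 + (u x)⁻¹ * elaplacian u x := by
  rw [elaplacian_eq_sum_fderiv_fderiv (differentiableAt_fderiv_of_contDiffOn hs hu hx),
    fderiv_log_of_pos hs hu hpos hx]
  simp only [fderiv_fderiv_log_of_pos hs hu hpos hx, Finset.sum_sub_distrib, ← Finset.mul_sum,
    smul_apply, smul_eq_mul]
  ring

end Coordinates

/-- **Lemma 7.1 (Euclidean case, first mutual control lemma).** For `n ≥ 2`, `q ≥ 0` and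
`p ∈ ℝ`, there is `C = C(n,p,q) > 0` such that every positive classical solution of
`Δu + |∇u|^q u^p = 0` on `B(x₀, 2R)` satisfies
`sup_(B(x₀,R)) |∇u|²/u² ≤ C (sup_(B(x₀,2R)) u^(p−1)|∇u|^q + 1/R²)`, expressed via an
arbitrary upper bound `M` of `u^(p−1)|∇u|^q` on `B(x₀,2R)`. -/
theorem mutual_control_first (n : ℕ) (hn : 2 ≤ n) (p q : ℝ) (hq : 0 ≤ q) :
    ∃ C > (0 : ℝ), ∀ (x₀ : EuclideanSpace ℝ (Fin n)) (R : ℝ), 0 < R →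
      ∀ u : EuclideanSpace ℝ (Fin n) → ℝ,
        ContDiffOn ℝ 2 u (Metric.ball x₀ (2 * R)) →
        (∀ x ∈ Metric.ball x₀ (2 * R), 0 < u x) →
        (∀ x ∈ Metric.ball x₀ (2 * R),
          elaplacian u x + ‖gradient u x‖ ^ q * u x ^ p = 0) →
        ∀ M : ℝ, (∀ y ∈ Metric.ball x₀ (2 * R), u y ^ (p - 1) * ‖gradient u y‖ ^ q ≤ M) →
        ∀ x ∈ Metric.ball x₀ R,
          ‖gradient u x‖ ^ 2 / u x ^ 2 ≤ C * (M + 1 / R ^ 2) := by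
  have hn1 : 1 ≤ n := by omega
  have hn0 : (0 : ℝ) < n := by exact_mod_cast hn1
  obtain ⟨η, hη⟩ : ∃ η : ℝ, η = 1 / (1000 * n) := ⟨_, rfl⟩
  have hη0 : 0 < η := by rw [hη]; positivity
  obtain ⟨N, hN⟩ : ∃ N : ℝ, N = (10 / η + 1) / (η / 2) := ⟨_, rfl⟩
  refine ⟨4 * N ^ 2 + 9 / η, by positivity, ?_⟩
  intro x₀ R hR u hu hpos heq M hM x hx
  have hs : IsOpen (Metric.ball x₀ (2 * R)) := Metric.isOpen_ball
  have hx2 : x ∈ Metric.ball x₀ (2 * R) := Metric.ball_subset_ball (by linarith) hx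
  have key := norm_fderiv_sq_le hn1 hη hN hR (w := fun y => Real.log (u y))
    (V := fun y => u y ^ (p - 1) * ‖gradient u y‖ ^ q)
    (hu.log fun y hy => (hpos y hy).ne')
    (fun y hy => mul_nonneg (Real.rpow_nonneg (hpos y hy).le _)
      (Real.rpow_nonneg (norm_nonneg _) _)) hM ?_ hx
  · rw [fderiv_log_of_pos hs hu hpos hx2, norm_smul, norm_inv, Real.norm_eq_abs,
      abs_of_pos (hpos x hx2), mul_pow, inv_pow] at key
    rwa [norm_gradient_eq, div_eq_inv_mul]
  · intro y hy
    rw [sum_fderiv_fderiv_log hs hu hpos hy, eq_neg_of_add_eq_zero_left (heq y hy),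
      Real.rpow_sub_one (hpos y hy).ne']
    ring
end

section
/- Let n ≥ 2, q ≥ 0 and p ∈ ℝ. Then there exists a constant C = C(n,p,q) > 0 such that for every x₀ ∈ ℝ^n, every R > 0 and every positive classical solution u of Δu + |∇u|^q u^p = 0 on the ball B(x₀, 2R) ⊂ ℝ^n, one has sup_{B(x₀,R)} u^{p−1}|∇u|^q ≤ C ( sup_{B(x₀,2R)} |∇u|²/u² + 1/R² ). -/
open scoped BigOperators

open Filter Topology

section CoordinateCalculus

variable {n : ℕ}

/-- The partial derivative in the `i`-th coordinate direction. -/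
noncomputable def pderiv (i : Fin n) (g : EuclideanSpace ℝ (Fin n) → ℝ)
    (x : EuclideanSpace ℝ (Fin n)) : ℝ :=
  fderiv ℝ g x (EuclideanSpace.single i 1)

variable {f g : EuclideanSpace ℝ (Fin n) → ℝ} {x : EuclideanSpace ℝ (Fin n)}

theorem elaplacian_eq_sum_pderiv : elaplacian g x = ∑ i, pderiv i (pderiv i g) x := rfl

theorem pderiv_congr (i : Fin n) (h : f =ᶠ[𝓝 x] g) : pderiv i f x = pderiv i g x := by
  simp only [pderiv, h.fderiv_eq]

theorem ContDiffAt.pderiv {k : WithTop ℕ∞} (i : Fin n) (hg : ContDiffAt ℝ (k + 1) g x) :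
    ContDiffAt ℝ k (pderiv i g) x :=
  (hg.fderiv_right le_rfl).clm_apply contDiffAt_const

theorem ContDiffAt.pderiv_two (i : Fin n) (hg : ContDiffAt ℝ 2 g x) :
    ContDiffAt ℝ 1 (_root_.pderiv i g) x :=
  ContDiffAt.pderiv i (by simpa [one_add_one_eq_two] using hg)

theorem ContDiffAt.differentiableAt_pderiv (i : Fin n) (hg : ContDiffAt ℝ 2 g x) :
    DifferentiableAt ℝ (_root_.pderiv i g) x :=
  (hg.pderiv_two i).differentiableAt (by simp)

theorem ContDiffAt.eventually_differentiableAt (hg : ContDiffAt ℝ 2 g x) :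
    ∀ᶠ y in 𝓝 x, DifferentiableAt ℝ g y :=
  (hg.eventually (by simp)).mono fun _ hy => hy.differentiableAt (by simp)

theorem pderiv_add (i : Fin n) (hf : DifferentiableAt ℝ f x) (hg : DifferentiableAt ℝ g x) :
    pderiv i (fun y => f y + g y) x = pderiv i f x + pderiv i g x := by
  simp [pderiv, fderiv_fun_add hf hg]

theorem pderiv_sub (i : Fin n) (hf : DifferentiableAt ℝ f x) (hg : DifferentiableAt ℝ g x) :
    pderiv i (fun y => f y - g y) x = pderiv i f x - pderiv i g x := by
  simp [pderiv, fderiv_fun_sub hf hg]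

theorem pderiv_const_mul (i : Fin n) (c : ℝ) (hf : DifferentiableAt ℝ f x) :
    pderiv i (fun y => c * f y) x = c * pderiv i f x := by
  simp [pderiv, fderiv_const_mul hf]

theorem pderiv_mul (i : Fin n) (hf : DifferentiableAt ℝ f x) (hg : DifferentiableAt ℝ g x) :
    pderiv i (fun y => f y * g y) x = f x * pderiv i g x + g x * pderiv i f x := by
  simp [pderiv, fderiv_fun_mul hf hg]

theorem pderiv_sq (i : Fin n) (hf : DifferentiableAt ℝ f x) :
    pderiv i (fun y => f y ^ 2) x = 2 * f x * pderiv i f x := by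
  simp [pderiv, fderiv_fun_pow 2 hf]

theorem pderiv_sum {ι : Type*} (s : Finset ι) (i : Fin n)
    {F : ι → EuclideanSpace ℝ (Fin n) → ℝ} (hF : ∀ k ∈ s, DifferentiableAt ℝ (F k) x) :
    pderiv i (fun y => ∑ k ∈ s, F k y) x = ∑ k ∈ s, pderiv i (F k) x := by
  simp [pderiv, fderiv_fun_sum hF]

theorem pderiv_log (i : Fin n) (hf : DifferentiableAt ℝ f x) (h0 : f x ≠ 0) :
    pderiv i (fun y => Real.log (f y)) x = pderiv i f x / f x := by
  simp [pderiv, fderiv.log hf h0, div_eq_inv_mul]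

theorem pderiv_comp_add_right (i : Fin n) (a : EuclideanSpace ℝ (Fin n)) :
    pderiv i (fun y => g (y + a)) x = pderiv i g (x + a) := by
  simp [pderiv, fderiv_comp_add_right]

theorem pderiv_coord (i k : Fin n) :
    pderiv i (fun y : EuclideanSpace ℝ (Fin n) => y k) x = if i = k then 1 else 0 := by
  have h : (fun y : EuclideanSpace ℝ (Fin n) => y k)
      = (EuclideanSpace.proj k : EuclideanSpace ℝ (Fin n) →L[ℝ] ℝ) := rfl
  rw [pderiv, h, ContinuousLinearMap.fderiv]
  simp [eq_comm]

theorem pderiv_const (i : Fin n) (c : ℝ) : pderiv i (fun _ => c) x = 0 := by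
  simp [pderiv]

theorem pderiv_comm (i j : Fin n) (hg : ContDiffAt ℝ 2 g x) :
    pderiv i (pderiv j g) x = pderiv j (pderiv i g) x := by
  have hs := hg.isSymmSndFDerivAt (by simp)
  have hd : DifferentiableAt ℝ (fderiv ℝ g) x :=
    (hg.fderiv_right (m := 1) (by simp [one_add_one_eq_two])).differentiableAt (by simp)
  have key : ∀ k l : Fin n, pderiv k (pderiv l g) x
      = fderiv ℝ (fderiv ℝ g) x (EuclideanSpace.single k 1) (EuclideanSpace.single l 1) := by
    intro k l
    have : pderiv l g = fun y => fderiv ℝ g y (EuclideanSpace.single l 1) := rfl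
    rw [pderiv, this, fderiv_clm_apply hd (differentiableAt_const _)]
    simp
  rw [key, key, hs]

theorem elaplacian_add (hf : ContDiffAt ℝ 2 f x) (hg : ContDiffAt ℝ 2 g x) :
    elaplacian (fun y => f y + g y) x = elaplacian f x + elaplacian g x := by
  simp only [elaplacian_eq_sum_pderiv, ← Finset.sum_add_distrib]
  refine Finset.sum_congr rfl fun i _ => ?_
  rw [← pderiv_add i (hf.differentiableAt_pderiv i) (hg.differentiableAt_pderiv i)]
  refine pderiv_congr i ?_
  filter_upwards [hf.eventually_differentiableAt, hg.eventually_differentiableAt] with y h1 h2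
  exact pderiv_add i h1 h2

theorem elaplacian_const_mul (c : ℝ) (hf : ContDiffAt ℝ 2 f x) :
    elaplacian (fun y => c * f y) x = c * elaplacian f x := by
  simp only [elaplacian_eq_sum_pderiv, Finset.mul_sum]
  refine Finset.sum_congr rfl fun i _ => ?_
  rw [← pderiv_const_mul i c (hf.differentiableAt_pderiv i)]
  refine pderiv_congr i ?_
  filter_upwards [hf.eventually_differentiableAt] with y h1
  exact pderiv_const_mul i c h1

theorem elaplacian_sub (hf : ContDiffAt ℝ 2 f x) (hg : ContDiffAt ℝ 2 g x) :
    elaplacian (fun y => f y - g y) x = elaplacian f x - elaplacian g x := by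
  have h := elaplacian_add hf (contDiffAt_const (c := (-1 : ℝ)) |>.mul hg)
  rw [elaplacian_const_mul _ hg] at h
  simpa [sub_eq_add_neg] using h

theorem elaplacian_sum {ι : Type*} (s : Finset ι) {F : ι → EuclideanSpace ℝ (Fin n) → ℝ}
    (hF : ∀ k ∈ s, ContDiffAt ℝ 2 (F k) x) :
    elaplacian (fun y => ∑ k ∈ s, F k y) x = ∑ k ∈ s, elaplacian (F k) x := by
  simp only [elaplacian_eq_sum_pderiv]
  rw [Finset.sum_comm]
  refine Finset.sum_congr rfl fun i _ => ?_
  rw [← pderiv_sum s i fun k hk => (hF k hk).differentiableAt_pderiv i]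
  refine pderiv_congr i ?_
  have : ∀ᶠ y in 𝓝 x, ∀ k ∈ s, DifferentiableAt ℝ (F k) y :=
    (Filter.eventually_all_finset s).2 fun k hk => (hF k hk).eventually_differentiableAt
  filter_upwards [this] with y hy
  exact pderiv_sum s i hy

theorem elaplacian_sq (hf : ContDiffAt ℝ 2 f x) :
    elaplacian (fun y => f y ^ 2) x
      = 2 * ∑ i, pderiv i f x ^ 2 + 2 * f x * elaplacian f x := by
  simp only [elaplacian_eq_sum_pderiv, Finset.mul_sum, ← Finset.sum_add_distrib]
  refine Finset.sum_congr rfl fun i _ => ?_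
  have hfd : DifferentiableAt ℝ f x := hf.differentiableAt (by simp)
  have h : pderiv i (fun y => f y ^ 2) =ᶠ[𝓝 x] fun y => 2 * (f y * pderiv i f y) := by
    filter_upwards [hf.eventually_differentiableAt] with y h1
    rw [pderiv_sq i h1, mul_assoc]
  rw [pderiv_congr i h, pderiv_const_mul i 2 (f := fun y => f y * pderiv i f y)
      (hfd.mul (hf.differentiableAt_pderiv i)),
    pderiv_mul i hfd (hf.differentiableAt_pderiv i)]
  ring

theorem elaplacian_log (hf : ContDiffAt ℝ 2 f x) (h0 : f x ≠ 0) :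
    elaplacian (fun y => Real.log (f y)) x
      = elaplacian f x / f x - (∑ i, pderiv i f x ^ 2) / f x ^ 2 := by
  have hfd : DifferentiableAt ℝ f x := hf.differentiableAt (by simp)
  have hlog : ContDiffAt ℝ 2 (fun y => Real.log (f y)) x := hf.log h0
  simp only [elaplacian_eq_sum_pderiv, Finset.sum_div, ← Finset.sum_sub_distrib]
  refine Finset.sum_congr rfl fun i _ => ?_
  have h : pderiv i f =ᶠ[𝓝 x] fun y => f y * pderiv i (fun y => Real.log (f y)) y := by
    filter_upwards [hf.eventually_differentiableAt, hfd.continuousAt.eventually_ne h0]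
      with y h1 h2
    rw [pderiv_log i h1 h2]
    field_simp
  rw [pderiv_congr i h, pderiv_mul i hfd (hlog.differentiableAt_pderiv i), pderiv_log i hfd h0]
  field_simp
  ring

theorem elaplacian_comp_add_right (a : EuclideanSpace ℝ (Fin n)) :
    elaplacian (fun y => g (y + a)) x = elaplacian g (x + a) := by
  have h : ∀ i, pderiv i (fun y => g (y + a)) = fun y => pderiv i g (y + a) := fun i =>
    funext fun y => pderiv_comp_add_right i a
  simp only [elaplacian_eq_sum_pderiv, h, pderiv_comp_add_right]

theorem pderiv_normSq (i : Fin n) (c : EuclideanSpace ℝ (Fin n)) :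
    pderiv i (fun y => ‖y - c‖ ^ 2) x = 2 * (x i - c i) := by
  have hd : ∀ k : Fin n, DifferentiableAt ℝ (fun y : EuclideanSpace ℝ (Fin n) => y k - c k) x :=
    fun k => by fun_prop
  simp only [EuclideanSpace.norm_sq_eq, PiLp.sub_apply, Real.norm_eq_abs, sq_abs]
  rw [pderiv_sum Finset.univ i (F := fun k y => (y k - c k) ^ 2) fun k _ => (hd k).pow 2]
  have : ∀ k, pderiv i (fun y : EuclideanSpace ℝ (Fin n) => (y k - c k) ^ 2) x
      = if i = k then 2 * (x k - c k) else 0 := by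
    intro k
    rw [pderiv_sq i (hd k), pderiv_sub i (by fun_prop) (by fun_prop), pderiv_coord, pderiv_const]
    split_ifs <;> simp
  simp [this]

theorem elaplacian_normSq (c : EuclideanSpace ℝ (Fin n)) :
    elaplacian (fun y => ‖y - c‖ ^ 2) x = 2 * n := by
  have h : ∀ i, pderiv i (fun y => ‖y - c‖ ^ 2)
      = fun y : EuclideanSpace ℝ (Fin n) => 2 * (y i - c i) := fun i =>
    funext fun y => pderiv_normSq i c
  have h2 : ∀ i, pderiv i (fun y : EuclideanSpace ℝ (Fin n) => 2 * (y i - c i)) x = 2 := by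
    intro i
    rw [pderiv_const_mul i 2 (by fun_prop), pderiv_sub i (by fun_prop) (by fun_prop),
      pderiv_coord, pderiv_const]
    simp
  simp [elaplacian_eq_sum_pderiv, h, h2, mul_comm]

theorem norm_gradient_sq : ‖gradient g x‖ ^ 2 = ∑ i, pderiv i g x ^ 2 := by
  rw [EuclideanSpace.norm_sq_eq]
  refine Finset.sum_congr rfl fun i _ => ?_
  have h : gradient g x i = pderiv i g x := by
    rw [pderiv, ← inner_gradient_left, EuclideanSpace.inner_single_right]
    simp
  rw [h, Real.norm_eq_abs, sq_abs]

theorem IsLocalMax.pderiv_eq_zero (h : IsLocalMax g x) (i : Fin n) : pderiv i g x = 0 := by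
  simp [pderiv, h.fderiv_eq_zero]

theorem IsLocalMax.pderiv_pderiv_nonpos (h : IsLocalMax g x) (hg : ContDiffAt ℝ 2 g x)
    (i : Fin n) : pderiv i (pderiv i g) x ≤ 0 := by
  by_contra! hpos
  set e : EuclideanSpace ℝ (Fin n) := EuclideanSpace.single i 1
  have hline : ∀ t : ℝ, HasDerivAt (fun t : ℝ => x + t • e) e t := fun t => by
    simpa using ((hasDerivAt_id t).smul_const e).const_add x
  have hcont : Tendsto (fun t : ℝ => x + t • e) (𝓝 0) (𝓝 x) := by
    simpa using (hline 0).continuousAt.tendsto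
  have hderiv : deriv (fun t : ℝ => g (x + t • e)) =ᶠ[𝓝 0] fun t => pderiv i g (x + t • e) := by
    filter_upwards [hcont.eventually hg.eventually_differentiableAt] with t ht
    exact (ht.hasFDerivAt.comp_hasDerivAt t (hline t)).deriv
  have hderiv2 : deriv (deriv (fun t : ℝ => g (x + t • e))) 0 = pderiv i (pderiv i g) x := by
    rw [hderiv.deriv_eq]
    have hd : DifferentiableAt ℝ (pderiv i g) (x + (0 : ℝ) • e) := by
      simpa using hg.differentiableAt_pderiv i
    have h := (hd.hasFDerivAt.comp_hasDerivAt 0 (hline 0)).deriv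
    rwa [zero_smul, add_zero] at h
  have hmax : IsLocalMax (fun t : ℝ => g (x + t • e)) 0 := by
    filter_upwards [hcont.eventually h] with t ht
    simpa using ht
  have hc : ContinuousAt (fun t : ℝ => g (x + t • e)) 0 := by
    refine ContinuousAt.comp ?_ (hline 0).continuousAt
    simpa using hg.continuousAt
  have hmin := isLocalMin_of_deriv_deriv_pos (hderiv2 ▸ hpos) hmax.deriv_eq_zero hc
  have hconst : (fun t : ℝ => g (x + t • e)) =ᶠ[𝓝 0] fun _ => g (x + (0 : ℝ) • e) := by
    filter_upwards [hmin, hmax] with t h1 h2 using le_antisymm h2 h1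
  have hconst' : deriv (fun t : ℝ => g (x + t • e)) =ᶠ[𝓝 0] fun _ => 0 := by
    filter_upwards [hconst.deriv] with t ht
    simpa using ht
  rw [← hderiv2, hconst'.deriv_eq] at hpos
  simp at hpos

theorem elaplacian_le_of_isLocalMax_sub {δ : ℝ} {c : EuclideanSpace ℝ (Fin n)}
    (hg : ContDiffAt ℝ 2 g x) (h : IsLocalMax (fun y => g y - δ * ‖y - c‖ ^ 2) x) :
    elaplacian g x ≤ 2 * n * δ := by
  have hq : ContDiffAt ℝ 2 (fun y => ‖y - c‖ ^ 2) x :=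
    (contDiffAt_id.sub contDiffAt_const).norm_sq ℝ
  have hq' := contDiffAt_const (c := δ) |>.mul hq
  have h0 : elaplacian (fun y => g y - δ * ‖y - c‖ ^ 2) x ≤ 0 :=
    Finset.sum_nonpos fun i _ => h.pderiv_pderiv_nonpos (hg.sub hq') i
  rw [elaplacian_sub hg hq', elaplacian_const_mul _ hq, elaplacian_normSq] at h0
  linarith

/-- Maximum principle for a limit of `C²` functions with converging Laplacians: the limit need
not be twice differentiable. -/
theorem IsLocalMax.laplacian_limit_nonpos {ι : Type*} {l : Filter ι} [l.NeBot]
    {G : ι → EuclideanSpace ℝ (Fin n) → ℝ} {H : ℝ} (hmax : IsLocalMax g x)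
    (hlim : ∀ᶠ y in 𝓝 x, Tendsto (fun z : ι × EuclideanSpace ℝ (Fin n) => G z.1 z.2)
      (l ×ˢ 𝓝 y) (𝓝 (g y)))
    (hsmooth : ∀ᶠ z in l ×ˢ 𝓝 x, ContDiffAt ℝ 2 (G z.1) z.2)
    (hlap : Tendsto (fun z : ι × EuclideanSpace ℝ (Fin n) => elaplacian (G z.1) z.2)
      (l ×ˢ 𝓝 x) (𝓝 H)) :
    H ≤ 0 := by
  by_contra! hH
  obtain ⟨δ, hδ, hδH⟩ : ∃ δ > 0, 2 * n * δ < H := by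
    refine ⟨H / (2 * n + 1), by positivity, ?_⟩
    rw [mul_div_assoc', div_lt_iff₀ (by positivity)]
    nlinarith
  obtain ⟨A, hA, B, hB, hAB⟩ := Filter.eventually_prod_iff.1
    (hsmooth.and (hlap.eventually (lt_mem_nhds hδH)))
  obtain ⟨r, hr, hball⟩ := Metric.nhds_basis_closedBall.mem_iff.1 ((hmax.and hlim).and hB)
  have hx : x ∈ Metric.closedBall x r := Metric.mem_closedBall_self hr.le
  have hsphere : ∀ᶠ h in l, ∀ y ∈ Metric.sphere x r, G h y - δ * r ^ 2 < g x - δ * r ^ 2 / 2 := by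
    have hmem : {z : ι × EuclideanSpace ℝ (Fin n) |
        G z.1 z.2 - δ * r ^ 2 < g x - δ * r ^ 2 / 2} ∈ l ×ˢ 𝓝ˢ (Metric.sphere x r) := by
      refine (isCompact_sphere x r).mem_prod_nhdsSet_of_forall fun y hy => ?_
      obtain ⟨⟨h1, h2⟩, -⟩ := hball (Metric.sphere_subset_closedBall hy)
      have : g y < g x + δ * r ^ 2 / 2 :=
        lt_of_le_of_lt h1 (by linarith [show 0 < δ * r ^ 2 by positivity])
      filter_upwards [h2.eventually (gt_mem_nhds this)] with z hz
      linarith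
    obtain ⟨P, hP, Q, hQ, hPQ⟩ := Filter.eventually_prod_iff.1 hmem
    filter_upwards [hP] with h hh y hy
    exact hPQ hh (subset_of_mem_nhdsSet hQ hy)
  have hcenter : ∀ᶠ h in l, g x - δ * r ^ 2 / 2 < G h x := by
    have hpair : Tendsto (fun h : ι => (h, x)) l (l ×ˢ 𝓝 x) :=
      tendsto_id.prodMk (tendsto_const_nhds)
    exact ((hball hx).1.2.comp hpair).eventually
      (lt_mem_nhds (by linarith [show 0 < δ * r ^ 2 by positivity]))
  obtain ⟨h, ⟨h1, h2⟩, h3⟩ := ((hsphere.and hcenter).and hA).exists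
  have hcont : ContinuousOn (fun y => G h y - δ * ‖y - x‖ ^ 2) (Metric.closedBall x r) := by
    intro y hy
    have := (hAB h3 (hball hy).2).1.continuousAt
    exact (this.sub (by fun_prop)).continuousWithinAt
  obtain ⟨y, hy, hymax⟩ := (isCompact_closedBall x r).exists_isMaxOn ⟨x, hx⟩ hcont
  have hyx : G h x - δ * ‖x - x‖ ^ 2 ≤ G h y - δ * ‖y - x‖ ^ 2 := hymax hx
  rw [sub_self, norm_zero] at hyx
  have hyball : y ∈ Metric.ball x r := by
    refine lt_of_le_of_ne (Metric.mem_closedBall.1 hy) fun hyr => ?_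
    have := h1 y hyr
    rw [dist_eq_norm] at hyr
    rw [hyr] at hyx
    linarith
  have hloc : IsLocalMax (fun y => G h y - δ * ‖y - x‖ ^ 2) y :=
    hymax.isLocalMax (Metric.closedBall_mem_nhds_of_mem hyball)
  obtain ⟨h4, h5⟩ := hAB h3 (hball hy).2
  exact absurd (elaplacian_le_of_isLocalMax_sub h4 hloc) (not_le.2 h5)

end CoordinateCalculus

section DifferenceQuotient

variable {n : ℕ}

/-- The forward difference quotient with step `h` in the `i`-th coordinate direction. -/
noncomputable def diffQuot (h : ℝ) (i : Fin n) (g : EuclideanSpace ℝ (Fin n) → ℝ)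
    (x : EuclideanSpace ℝ (Fin n)) : ℝ :=
  h⁻¹ * (g (x + h • EuclideanSpace.single i 1) - g x)

variable {g : EuclideanSpace ℝ (Fin n) → ℝ} {x : EuclideanSpace ℝ (Fin n)} {h : ℝ} {i : Fin n}

theorem tendsto_add_smul_single (i : Fin n) (x : EuclideanSpace ℝ (Fin n)) :
    Tendsto (fun z : ℝ × EuclideanSpace ℝ (Fin n) => z.2 + z.1 • EuclideanSpace.single i (1 : ℝ))
      (𝓝[>] 0 ×ˢ 𝓝 x) (𝓝 x) := by
  have h1 : Tendsto (fun z : ℝ × EuclideanSpace ℝ (Fin n) => z.1) (𝓝[>] 0 ×ˢ 𝓝 x) (𝓝 0) :=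
    tendsto_fst.mono_right nhdsWithin_le_nhds
  have h2 : Tendsto (fun z : ℝ × EuclideanSpace ℝ (Fin n) => z.2) (𝓝[>] 0 ×ˢ 𝓝 x) (𝓝 x) :=
    tendsto_snd
  simpa using h2.add (h1.smul_const (EuclideanSpace.single i (1 : ℝ)))

theorem tendsto_diffQuot (i : Fin n) (hg : ContDiffAt ℝ 1 g x) :
    Tendsto (fun z : ℝ × EuclideanSpace ℝ (Fin n) => diffQuot z.1 i g z.2)
      (𝓝[>] 0 ×ˢ 𝓝 x) (𝓝 (pderiv i g x)) := by
  set e : EuclideanSpace ℝ (Fin n) := EuclideanSpace.single i 1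
  have hpair : Tendsto (fun z : ℝ × EuclideanSpace ℝ (Fin n) => (z.2 + z.1 • e, z.2))
      (𝓝[>] 0 ×ˢ 𝓝 x) (𝓝 (x, x)) := by
    rw [nhds_prod_eq]
    exact (tendsto_add_smul_single i x).prodMk tendsto_snd
  have ho := (hg.hasStrictFDerivAt (by simp)).isLittleO.comp_tendsto hpair
  have hO : (fun z : ℝ × EuclideanSpace ℝ (Fin n) => z.1 • e)
      =O[𝓝[>] 0 ×ˢ 𝓝 x] fun z => z.1 := by
    refine Asymptotics.IsBigO.of_bound ‖e‖ (Eventually.of_forall fun z => ?_)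
    rw [norm_smul, mul_comm]
  have ho2 : (fun z : ℝ × EuclideanSpace ℝ (Fin n) =>
      g (z.2 + z.1 • e) - g z.2 - z.1 * pderiv i g x) =o[𝓝[>] 0 ×ˢ 𝓝 x] fun z => z.1 := by
    refine Asymptotics.IsLittleO.trans_isBigO ?_ hO
    simpa [Function.comp_def, pderiv] using ho
  have hpos : ∀ᶠ z : ℝ × EuclideanSpace ℝ (Fin n) in 𝓝[>] 0 ×ˢ 𝓝 x, 0 < z.1 :=
    tendsto_fst.eventually self_mem_nhdsWithin
  have hadd := ho2.tendsto_div_nhds_zero.add_const (pderiv i g x)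
  rw [zero_add] at hadd
  refine hadd.congr' ?_
  filter_upwards [hpos] with z hz
  rw [diffQuot]
  field_simp
  ring

theorem ContDiffAt.diffQuot {k : WithTop ℕ∞} (hg : ContDiffAt ℝ k g x)
    (hg' : ContDiffAt ℝ k g (x + h • EuclideanSpace.single i 1)) :
    ContDiffAt ℝ k (diffQuot h i g) x := by
  have hs : ContDiffAt ℝ k (fun y => g (y + h • EuclideanSpace.single i (1 : ℝ))) x :=
    ContDiffAt.comp x hg' (contDiffAt_id.add contDiffAt_const)
  exact contDiffAt_const.mul (hs.sub hg)

theorem pderiv_diffQuot (j : Fin n) (hg : DifferentiableAt ℝ g x)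
    (hg' : DifferentiableAt ℝ g (x + h • EuclideanSpace.single i 1)) :
    pderiv j (diffQuot h i g) x = diffQuot h i (pderiv j g) x := by
  have hs : DifferentiableAt ℝ (fun y => g (y + h • EuclideanSpace.single i (1 : ℝ))) x :=
    DifferentiableAt.comp x hg' (differentiableAt_id.add_const _)
  have := pderiv_const_mul j h⁻¹ (hs.sub hg)
  rw [diffQuot, ← pderiv_comp_add_right, ← pderiv_sub j hs hg]
  exact this

theorem elaplacian_diffQuot (hg : ContDiffAt ℝ 2 g x)
    (hg' : ContDiffAt ℝ 2 g (x + h • EuclideanSpace.single i 1)) :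
    elaplacian (diffQuot h i g) x = diffQuot h i (elaplacian g) x := by
  have hs : ContDiffAt ℝ 2 (fun y => g (y + h • EuclideanSpace.single i (1 : ℝ))) x :=
    ContDiffAt.comp x hg' (contDiffAt_id.add contDiffAt_const)
  have := elaplacian_const_mul h⁻¹ (hs.sub hg)
  rw [diffQuot, ← elaplacian_comp_add_right, ← elaplacian_sub hs hg]
  exact this

theorem ContDiffAt.continuousAt_elaplacian (hg : ContDiffAt ℝ 2 g x) :
    ContinuousAt (elaplacian g) x := by
  have h : elaplacian g = fun y => ∑ i, _root_.pderiv i (_root_.pderiv i g) y := rfl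
  rw [h]
  refine tendsto_finsetSum _ fun i _ => ?_
  exact (ContDiffAt.pderiv (k := 0) i (by simpa using hg.pderiv_two i)).continuousAt

theorem elaplacian_sum_sq {ι : Type*} (s : Finset ι) {F : ι → EuclideanSpace ℝ (Fin n) → ℝ}
    (hF : ∀ k ∈ s, ContDiffAt ℝ 2 (F k) x) :
    elaplacian (fun y => ∑ k ∈ s, F k y ^ 2) x
      = ∑ k ∈ s, (2 * ∑ j, pderiv j (F k) x ^ 2 + 2 * F k x * elaplacian (F k) x) := by
  rw [elaplacian_sum s (F := fun k y => F k y ^ 2) fun k hk => (hF k hk).pow 2]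
  exact Finset.sum_congr rfl fun k hk => elaplacian_sq (hF k hk)

theorem pderiv_sum_sq {ι : Type*} (s : Finset ι) (j : Fin n)
    {F : ι → EuclideanSpace ℝ (Fin n) → ℝ} (hF : ∀ k ∈ s, DifferentiableAt ℝ (F k) x) :
    pderiv j (fun y => ∑ k ∈ s, F k y ^ 2) x = ∑ k ∈ s, 2 * F k x * pderiv j (F k) x := by
  rw [pderiv_sum s j (F := fun k y => F k y ^ 2) fun k hk => (hF k hk).pow 2]
  exact Finset.sum_congr rfl fun k hk => pderiv_sq j (hF k hk)

theorem elaplacian_log_combination {a b c : EuclideanSpace ℝ (Fin n) → ℝ} {γ α : ℝ}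
    (ha : ContDiffAt ℝ 2 a x) (hb : ContDiffAt ℝ 2 b x) (hc : ContDiffAt ℝ 2 c x)
    (ha0 : a x ≠ 0) (hb0 : b x ≠ 0) (hc0 : c x ≠ 0) :
    elaplacian (fun y => Real.log (a y) + γ * Real.log (b y) + α * Real.log (c y)) x
      = elaplacian a x / a x - (∑ i, pderiv i a x ^ 2) / a x ^ 2
        + γ * (elaplacian b x / b x - (∑ i, pderiv i b x ^ 2) / b x ^ 2)
        + α * (elaplacian c x / c x - (∑ i, pderiv i c x ^ 2) / c x ^ 2) := by
  have hb' := hb.log hb0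
  have hc' := hc.log hc0
  have hγ := contDiffAt_const (c := γ) |>.mul hb'
  have hα := contDiffAt_const (c := α) |>.mul hc'
  rw [elaplacian_add ((ha.log ha0).add hγ) hα, elaplacian_add (ha.log ha0) hγ,
    elaplacian_const_mul γ hb', elaplacian_const_mul α hc', elaplacian_log ha ha0,
    elaplacian_log hb hb0, elaplacian_log hc hc0]

/-- Second-order condition at a local maximum of `log |∇u|² + γ log u + α log φ`, for `u` only
`C²` with `C¹` Laplacian. -/
theorem bochner_at_isLocalMax {u φ : EuclideanSpace ℝ (Fin n) → ℝ} {γ α : ℝ}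
    (hu : ContDiffAt ℝ 2 u x) (hφ : ContDiffAt ℝ 2 φ x) (hΔ : ContDiffAt ℝ 1 (elaplacian u) x)
    (hu0 : u x ≠ 0) (hφ0 : φ x ≠ 0) (hz0 : ∑ i, pderiv i u x ^ 2 ≠ 0)
    (hmax : IsLocalMax (fun y => Real.log (∑ i, pderiv i u y ^ 2) + γ * Real.log (u y)
      + α * Real.log (φ y)) x) :
    (∑ i, (2 * ∑ j, pderiv j (pderiv i u) x ^ 2 + 2 * pderiv i u x * pderiv i (elaplacian u) x))
        / (∑ i, pderiv i u x ^ 2)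
      - (∑ j, (∑ i, 2 * pderiv i u x * pderiv j (pderiv i u) x) ^ 2)
        / (∑ i, pderiv i u x ^ 2) ^ 2
      + γ * (elaplacian u x / u x - (∑ i, pderiv i u x ^ 2) / u x ^ 2)
      + α * (elaplacian φ x / φ x - (∑ i, pderiv i φ x ^ 2) / φ x ^ 2) ≤ 0 := by
  have hsnd : ∀ y, Tendsto (fun z : ℝ × EuclideanSpace ℝ (Fin n) => z.2) (𝓝[>] 0 ×ˢ 𝓝 y) (𝓝 y) :=
    fun y => tendsto_snd
  have hgrad : ContinuousAt (fun y => ∑ i, pderiv i u y ^ 2) x :=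
    tendsto_finsetSum _ fun i _ => (hu.pderiv_two i).continuousAt.pow 2
  have hdq : ∀ y, ContDiffAt ℝ 2 u y → Tendsto
      (fun z : ℝ × EuclideanSpace ℝ (Fin n) => ∑ i, diffQuot z.1 i u z.2 ^ 2)
      (𝓝[>] 0 ×ˢ 𝓝 y) (𝓝 (∑ i, pderiv i u y ^ 2)) := fun y hy =>
    tendsto_finsetSum _ fun i _ => (tendsto_diffQuot i (hy.of_le (by norm_num))).pow 2
  have hev : ∀ᶠ z : ℝ × EuclideanSpace ℝ (Fin n) in 𝓝[>] 0 ×ˢ 𝓝 x,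
      (ContDiffAt ℝ 2 u z.2 ∧ u z.2 ≠ 0) ∧ (ContDiffAt ℝ 2 φ z.2 ∧ φ z.2 ≠ 0) ∧
      ∑ i, diffQuot z.1 i u z.2 ^ 2 ≠ 0 ∧
      ∀ i, ContDiffAt ℝ 2 u (z.2 + z.1 • EuclideanSpace.single i 1) := by
    refine (((hsnd x).eventually ((hu.eventually (by simp)).and
      (hu.continuousAt.eventually_ne hu0)))).and (((hsnd x).eventually
      ((hφ.eventually (by simp)).and (hφ.continuousAt.eventually_ne hφ0))).and
      (((hdq x hu).eventually_ne hz0).and (eventually_all.2 fun i => ?_)))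
    exact (tendsto_add_smul_single i x).eventually (hu.eventually (by simp))
  refine hmax.laplacian_limit_nonpos (l := 𝓝[>] (0 : ℝ))
    (G := fun h y => Real.log (∑ i, diffQuot h i u y ^ 2) + γ * Real.log (u y)
      + α * Real.log (φ y)) ?_ ?_ ?_
  · filter_upwards [hu.eventually (by simp), hφ.eventually (by simp),
      hu.continuousAt.eventually_ne hu0, hφ.continuousAt.eventually_ne hφ0,
      hgrad.eventually_ne hz0] with y h1 h2 h3 h4 h5
    exact (((hdq y h1).log h5).add (((h1.continuousAt.tendsto.comp (hsnd y)).log h3).const_mul γ)).add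
      (((h2.continuousAt.tendsto.comp (hsnd y)).log h4).const_mul α)
  · filter_upwards [hev] with z ⟨⟨h1, h2⟩, ⟨h3, h4⟩, h5, h6⟩
    have hsum : ContDiffAt ℝ 2 (fun y => ∑ i, diffQuot z.1 i u y ^ 2) z.2 :=
      ContDiffAt.sum fun i _ => (h1.diffQuot (h6 i)).pow 2
    exact ((hsum.log h5).add (contDiffAt_const.mul (h1.log h2))).add
      (contDiffAt_const.mul (h3.log h4))
  · have hformula : ∀ᶠ z : ℝ × EuclideanSpace ℝ (Fin n) in 𝓝[>] 0 ×ˢ 𝓝 x,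
        (∑ i, (2 * ∑ j, diffQuot z.1 i (pderiv j u) z.2 ^ 2
          + 2 * diffQuot z.1 i u z.2 * diffQuot z.1 i (elaplacian u) z.2))
            / (∑ i, diffQuot z.1 i u z.2 ^ 2)
          - (∑ j, (∑ i, 2 * diffQuot z.1 i u z.2 * diffQuot z.1 i (pderiv j u) z.2) ^ 2)
            / (∑ i, diffQuot z.1 i u z.2 ^ 2) ^ 2
          + γ * (elaplacian u z.2 / u z.2 - (∑ i, pderiv i u z.2 ^ 2) / u z.2 ^ 2)
          + α * (elaplacian φ z.2 / φ z.2 - (∑ i, pderiv i φ z.2 ^ 2) / φ z.2 ^ 2)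
        = elaplacian (fun y => Real.log (∑ i, diffQuot z.1 i u y ^ 2) + γ * Real.log (u y)
            + α * Real.log (φ y)) z.2 := by
      filter_upwards [hev] with z ⟨⟨h1, h2⟩, ⟨h3, h4⟩, h5, h6⟩
      have hd : ∀ i ∈ Finset.univ, ContDiffAt ℝ 2 (diffQuot z.1 i u) z.2 :=
        fun i _ => h1.diffQuot (h6 i)
      have hsum : ContDiffAt ℝ 2 (fun y => ∑ i, diffQuot z.1 i u y ^ 2) z.2 :=
        ContDiffAt.sum fun i hi => (hd i hi).pow 2
      have h1' := h1.differentiableAt (by simp)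
      have h6' := fun i => (h6 i).differentiableAt (by simp)
      rw [elaplacian_log_combination hsum h1 h3 h5 h2 h4, elaplacian_sum_sq _ hd]
      simp only [pderiv_sum_sq _ _ fun i hi => (hd i hi).differentiableAt (by simp),
        fun i j => pderiv_diffQuot (h := z.1) (i := i) j h1' (h6' i),
        fun i => elaplacian_diffQuot h1 (h6 i)]
    refine Tendsto.congr' hformula ?_
    have hd : ∀ i, Tendsto (fun z : ℝ × EuclideanSpace ℝ (Fin n) => diffQuot z.1 i u z.2)
        (𝓝[>] 0 ×ˢ 𝓝 x) (𝓝 (pderiv i u x)) :=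
      fun i => tendsto_diffQuot i (hu.of_le (by norm_num))
    have hdd : ∀ i j, Tendsto (fun z : ℝ × EuclideanSpace ℝ (Fin n) =>
        diffQuot z.1 i (pderiv j u) z.2) (𝓝[>] 0 ×ˢ 𝓝 x) (𝓝 (pderiv j (pderiv i u) x)) :=
      fun i j => pderiv_comm i j hu ▸ tendsto_diffQuot i (hu.pderiv_two j)
    have hdΔ : ∀ i, Tendsto (fun z : ℝ × EuclideanSpace ℝ (Fin n) =>
        diffQuot z.1 i (elaplacian u) z.2) (𝓝[>] 0 ×ˢ 𝓝 x) (𝓝 (pderiv i (elaplacian u) x)) :=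
      fun i => tendsto_diffQuot i hΔ
    have hlog : ∀ {w : EuclideanSpace ℝ (Fin n) → ℝ}, ContDiffAt ℝ 2 w x → w x ≠ 0 →
        Tendsto (fun z : ℝ × EuclideanSpace ℝ (Fin n) =>
          elaplacian w z.2 / w z.2 - (∑ i, pderiv i w z.2 ^ 2) / w z.2 ^ 2) (𝓝[>] 0 ×ˢ 𝓝 x)
          (𝓝 (elaplacian w x / w x - (∑ i, pderiv i w x ^ 2) / w x ^ 2)) := by
      intro w hw hw0
      have hw' := hw.continuousAt.tendsto.comp (hsnd x)
      refine ((hw.continuousAt_elaplacian.tendsto.comp (hsnd x)).div hw' hw0).sub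
        ((tendsto_finsetSum _ fun i _ => ?_).div (hw'.pow 2) (pow_ne_zero 2 hw0))
      exact ((hw.pderiv_two i).continuousAt.tendsto.comp (hsnd x)).pow 2
    refine Tendsto.add (Tendsto.add (Tendsto.sub (Tendsto.div ?_ (hdq x hu) hz0)
      (Tendsto.div ?_ ((hdq x hu).pow 2) (pow_ne_zero 2 hz0))) ((hlog hu hu0).const_mul γ))
      ((hlog hφ hφ0).const_mul α)
    · exact tendsto_finsetSum _ fun i _ =>
        ((tendsto_finsetSum _ fun j _ => (hdd i j).pow 2).const_mul 2).add
          (((hd i).const_mul 2).mul (hdΔ i))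
    · exact tendsto_finsetSum _ fun j _ =>
        (tendsto_finsetSum _ fun i _ => ((hd i).const_mul 2).mul (hdd i j)).pow 2

end DifferenceQuotient

section PositiveExponent

/-- The constant in the estimate for `q > 0`. -/
noncomputable def controlConstant (N γ α : ℝ) : ℝ :=
  N / 2 * (10 + |γ| + (γ ^ 2 + 4 * |γ| * α + 4 * α ^ 2 + |γ| + α * (2 * N + 4))) + 1

theorem one_le_controlConstant {N γ α : ℝ} (hN : 0 ≤ N) (hα : 0 ≤ α) :
    1 ≤ controlConstant N γ α := by
  rw [controlConstant]
  linarith [show 0 ≤ N / 2 * (10 + |γ| + (γ ^ 2 + 4 * |γ| * α + 4 * α ^ 2 + |γ|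
    + α * (2 * N + 4))) by positivity]

theorem le_controlConstant_mul {N F W X B D S γ α : ℝ} (hN : 0 < N) (hα : 0 ≤ α) (hF : 0 ≤ F)
    (hW : 0 ≤ W) (hWS : W ≤ S) (hX : X ^ 2 ≤ W * B) (hB : 0 ≤ B) (hBS : B ≤ 4 * S)
    (hD : D ≤ 2 * N * S)
    (h : 2 / N * F ^ 2 ≤ 2 * F * (W - 2 * X) + W * (γ ^ 2 * W + 2 * γ * α * X + α ^ 2 * B
      + γ * (F + W) + α * (D + B))) :
    F ≤ controlConstant N γ α * S := by
  have hS : 0 ≤ S := hW.trans hWS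
  have hXS : |X| ≤ 2 * S := by
    refine abs_le_of_sq_le_sq (hX.trans ?_) (by positivity)
    calc W * B ≤ S * (4 * S) := by gcongr
      _ = (2 * S) ^ 2 := by ring
  have hX1 : -X ≤ 2 * S := (neg_le_abs X).trans hXS
  have hγX : γ * X ≤ |γ| * (2 * S) := by
    calc γ * X ≤ |γ * X| := le_abs_self _
      _ = |γ| * |X| := abs_mul _ _
      _ ≤ |γ| * (2 * S) := by gcongr
  have h1 : 2 * F * (W - 2 * X) ≤ 2 * F * (5 * S) := by
    gcongr
    linarith
  have h2 : γ ^ 2 * W + 2 * γ * α * X + α ^ 2 * B + γ * (F + W) + α * (D + B)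
      ≤ γ ^ 2 * S + 4 * |γ| * α * S + 4 * α ^ 2 * S + |γ| * (F + S) + α * (2 * N + 4) * S := by
    have e1 : γ ^ 2 * W ≤ γ ^ 2 * S := by gcongr
    have e2 : α * (γ * X) ≤ α * (|γ| * (2 * S)) := by gcongr
    have e3 : α ^ 2 * B ≤ α ^ 2 * (4 * S) := by gcongr
    have e4 : γ * (F + W) ≤ |γ| * (F + S) := by
      gcongr
      exact le_abs_self γ
    have e5 : α * (D + B) ≤ α * (2 * N * S + 4 * S) := by gcongr
    linarith
  have h3 : 0 ≤ γ ^ 2 * S + 4 * |γ| * α * S + 4 * α ^ 2 * S + |γ| * (F + S)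
      + α * (2 * N + 4) * S := by positivity
  have h4 := h.trans (add_le_add h1 ((mul_le_mul_of_nonneg_left h2 hW).trans
    (mul_le_mul_of_nonneg_right hWS h3)))
  have h5 : F ^ 2 ≤ N / 2 * ((10 + |γ|) * (F * S) + (γ ^ 2 + 4 * |γ| * α + 4 * α ^ 2 + |γ|
      + α * (2 * N + 4)) * S ^ 2) := by
    have := mul_le_mul_of_nonneg_left h4 (show 0 ≤ N / 2 by positivity)
    calc F ^ 2 = N / 2 * (2 / N * F ^ 2) := by field_simp
      _ ≤ _ := this
      _ = _ := by ring
  by_contra! hlt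
  have hK := one_le_controlConstant (γ := γ) hN.le hα
  have hSF : S ≤ F := (le_mul_of_one_le_left hS hK).trans hlt.le
  have hFpos : 0 < F := lt_of_le_of_lt (by positivity) hlt
  have h6 : F * (controlConstant N γ α * S) < F * F := mul_lt_mul_of_pos_left hlt hFpos
  have h7 : N / 2 * ((10 + |γ|) * (F * S) + (γ ^ 2 + 4 * |γ| * α + 4 * α ^ 2 + |γ|
      + α * (2 * N + 4)) * S ^ 2) ≤ N / 2 * ((10 + |γ|) * (F * S) + (γ ^ 2 + 4 * |γ| * α
      + 4 * α ^ 2 + |γ| + α * (2 * N + 4)) * (F * S)) := by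
    rw [sq S]
    gcongr
  rw [controlConstant] at h6
  nlinarith [mul_nonneg hF hS]

theorem bernstein_inequality {n : ℕ} (hn : 0 < n) {a b df : Fin n → ℝ} {H : Fin n → Fin n → ℝ}
    {U Φ F z p q γ α Δφ : ℝ} (hU : 0 < U) (hΦ : 0 < Φ) (hz : 0 < z) (hza : z = ∑ i, a i ^ 2)
    (hγ : q * γ = 2 * (p - 1)) (hα : q * α = 4)
    (htrace : ∑ i, H i i = -(F * U))
    (hcrit : ∀ j, (∑ i, 2 * a i * H i j) / z + γ * (a j / U) + α * (b j / Φ) = 0)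
    (hdf : ∀ j, df j = -(F * U) * (q / 2 * ((∑ i, 2 * a i * H i j) / z) + p * (a j / U)))
    (hmax : (∑ i, (2 * ∑ j, H i j ^ 2 + 2 * a i * df i)) / z
      - (∑ j, (∑ i, 2 * a i * H i j) ^ 2) / z ^ 2
      + γ * (-(F * U) / U - z / U ^ 2) + α * (Δφ / Φ - (∑ i, b i ^ 2) / Φ ^ 2) ≤ 0) :
    2 / n * F ^ 2 ≤ 2 * F * (z / U ^ 2 - 2 * ((∑ i, a i * b i) / (U * Φ)))
      + z / U ^ 2 * (γ ^ 2 * (z / U ^ 2) + 2 * γ * α * ((∑ i, a i * b i) / (U * Φ))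
      + α ^ 2 * ((∑ i, b i ^ 2) / Φ ^ 2) + γ * (F + z / U ^ 2)
      + α * (-Δφ / Φ + (∑ i, b i ^ 2) / Φ ^ 2)) := by
  have hn' : (0 : ℝ) < n := by exact_mod_cast hn
  have hquad : (∑ j, (∑ i, 2 * a i * H i j) ^ 2) / z ^ 2 = γ ^ 2 * (z / U ^ 2)
      + 2 * γ * α * ((∑ i, a i * b i) / (U * Φ)) + α ^ 2 * ((∑ i, b i ^ 2) / Φ ^ 2) := by
    have h1 : ∀ j, (∑ i, 2 * a i * H i j) ^ 2 / z ^ 2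
        = γ ^ 2 / U ^ 2 * a j ^ 2 + 2 * γ * α / (U * Φ) * (a j * b j)
          + α ^ 2 / Φ ^ 2 * b j ^ 2 := by
      intro j
      have : (∑ i, 2 * a i * H i j) / z = -(γ * (a j / U) + α * (b j / Φ)) := by
        linarith [hcrit j]
      rw [← div_pow, this]
      field_simp
      ring
    rw [Finset.sum_div]
    simp only [h1, Finset.sum_add_distrib, ← Finset.mul_sum]
    rw [← hza]
    ring
  have hcross : ∑ i, a i * df i = -F * (z - 2 * (U / Φ * ∑ i, a i * b i)) := by
    have h1 : ∀ i, a i * df i = -F * (a i ^ 2 - 2 * (U / Φ * (a i * b i))) := by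
      intro i
      have : (∑ k, 2 * a k * H k i) / z = -(γ * (a i / U) + α * (b i / Φ)) := by
        linarith [hcrit i]
      have h2 : q / 2 * -(γ * (a i / U) + α * (b i / Φ))
          = -((p - 1) * (a i / U) + 2 * (b i / Φ)) := by
        linear_combination (-(a i / U) / 2) * hγ - (b i / Φ / 2) * hα
      rw [hdf, this, h2]
      field_simp
      ring
    simp only [h1, ← Finset.mul_sum, Finset.sum_sub_distrib, ← hza]
  have hhess : (F * U) ^ 2 / n ≤ ∑ i, ∑ j, H i j ^ 2 := by
    have h1 : (∑ i, H i i) ^ 2 ≤ n * ∑ i, H i i ^ 2 := by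
      simpa using sq_sum_le_card_mul_sum_sq (s := Finset.univ) (f := fun i => H i i)
    rw [htrace, neg_sq] at h1
    rw [div_le_iff₀' hn']
    refine h1.trans ?_
    gcongr with i _
    exact Finset.single_le_sum (f := fun j => H i j ^ 2) (fun j _ => sq_nonneg _)
      (Finset.mem_univ i)
  have hsum : ∑ i, (2 * ∑ j, H i j ^ 2 + 2 * a i * df i)
      = 2 * ∑ i, ∑ j, H i j ^ 2 + 2 * ∑ i, a i * df i := by
    simp only [Finset.sum_add_distrib, Finset.mul_sum, mul_assoc]
  rw [hquad, hsum, hcross] at hmax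
  have hmain := mul_le_mul_of_nonneg_left hmax (show 0 ≤ z / U ^ 2 by positivity)
  have hh : 2 / n * F ^ 2 ≤ 2 * (∑ i, ∑ j, H i j ^ 2) / U ^ 2 := by
    rw [le_div_iff₀ (by positivity)]
    calc 2 / n * F ^ 2 * U ^ 2 = 2 * ((F * U) ^ 2 / n) := by ring
      _ ≤ _ := by gcongr
  have hexpand : z / U ^ 2 * ((2 * ∑ i, ∑ j, H i j ^ 2
      + 2 * (-F * (z - 2 * (U / Φ * ∑ i, a i * b i)))) / z)
      = 2 * (∑ i, ∑ j, H i j ^ 2) / U ^ 2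
        - 2 * F * (z / U ^ 2 - 2 * ((∑ i, a i * b i) / (U * Φ))) := by
    field_simp
    ring
  have hFU : -(F * U) / U = -F := by field_simp
  rw [hFU, mul_zero] at hmain
  rw [neg_div]
  linarith [hmain, hexpand, hh]

end PositiveExponent

section CenterEstimate

variable {n : ℕ} {u : EuclideanSpace ℝ (Fin n) → ℝ} {c x : EuclideanSpace ℝ (Fin n)}
  {p q R M : ℝ}

theorem norm_gradient_rpow (q : ℝ) :
    ‖gradient u x‖ ^ q = (∑ i, pderiv i u x ^ 2) ^ (q / 2) := by
  rw [← norm_gradient_sq, ← Real.rpow_natCast, ← Real.rpow_mul (norm_nonneg _)]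
  congr 1
  push_cast
  ring

theorem elaplacian_eventuallyEq
    (heq : ∀ᶠ y in 𝓝 x, elaplacian u y + ‖gradient u y‖ ^ q * u y ^ p = 0) :
    elaplacian u =ᶠ[𝓝 x] fun y => -((∑ i, pderiv i u y ^ 2) ^ (q / 2) * u y ^ p) := by
  filter_upwards [heq] with y hy
  rw [← norm_gradient_rpow]
  linarith

theorem contDiffAt_sum_pderiv_sq (hu : ContDiffAt ℝ 2 u x) :
    ContDiffAt ℝ 1 (fun y => ∑ i, pderiv i u y ^ 2) x :=
  ContDiffAt.sum fun i _ => (hu.pderiv_two i).pow 2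

theorem contDiffAt_elaplacian_of_equation (hu : ContDiffAt ℝ 2 u x) (hu0 : 0 < u x)
    (hz : 0 < ∑ i, pderiv i u x ^ 2)
    (heq : ∀ᶠ y in 𝓝 x, elaplacian u y + ‖gradient u y‖ ^ q * u y ^ p = 0) :
    ContDiffAt ℝ 1 (elaplacian u) x :=
  ((((contDiffAt_sum_pderiv_sq hu).rpow_const_of_ne hz.ne').mul
    ((hu.of_le (by norm_num)).rpow_const_of_ne hu0.ne')).neg).congr_of_eventuallyEq
      (elaplacian_eventuallyEq heq)

theorem pderiv_elaplacian_of_equation (hu : ContDiffAt ℝ 2 u x) (hu0 : 0 < u x)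
    (hz : 0 < ∑ i, pderiv i u x ^ 2)
    (heq : ∀ᶠ y in 𝓝 x, elaplacian u y + ‖gradient u y‖ ^ q * u y ^ p = 0) (j : Fin n) :
    pderiv j (elaplacian u) x = elaplacian u x *
      (q / 2 * ((∑ i, 2 * pderiv i u x * pderiv j (pderiv i u) x) / ∑ i, pderiv i u x ^ 2)
        + p * (pderiv j u x / u x)) := by
  have hΔ := elaplacian_eventuallyEq heq
  have hΔd := (contDiffAt_elaplacian_of_equation hu hu0 hz heq).differentiableAt (by simp)
  have hud : DifferentiableAt ℝ u x := hu.differentiableAt (by simp)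
  have hzd := (contDiffAt_sum_pderiv_sq hu).differentiableAt (by simp)
  have hΔ0 : elaplacian u x ≠ 0 := by
    rw [hΔ.eq_of_nhds]
    exact neg_ne_zero.2 (by positivity)
  have hlog : (fun y => Real.log (elaplacian u y)) =ᶠ[𝓝 x]
      fun y => q / 2 * Real.log (∑ i, pderiv i u y ^ 2) + p * Real.log (u y) := by
    filter_upwards [hΔ, hud.continuousAt.eventually (lt_mem_nhds hu0),
      hzd.continuousAt.eventually (lt_mem_nhds hz)] with y h1 h2 h3
    rw [h1, Real.log_neg_eq_log, Real.log_mul (by positivity) (by positivity),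
      Real.log_rpow h3, Real.log_rpow h2]
  have h := pderiv_congr j hlog
  rw [pderiv_log j hΔd hΔ0, pderiv_add j ((hzd.log hz.ne').const_mul _)
    ((hud.log hu0.ne').const_mul _), pderiv_const_mul j _ (hzd.log hz.ne'),
    pderiv_const_mul j _ (hud.log hu0.ne'), pderiv_log j hzd hz.ne', pderiv_log j hud hu0.ne',
    pderiv_sum_sq _ j fun i _ => hu.differentiableAt_pderiv i, div_eq_iff hΔ0] at h
  rw [h, mul_comm]

theorem control_at_isLocalMax {φ : EuclideanSpace ℝ (Fin n) → ℝ} (hq : 0 < q)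
    (hu : ContDiffAt ℝ 2 u x) (hφ : ContDiffAt ℝ 2 φ x) (hu0 : 0 < u x) (hφ0 : 0 < φ x)
    (hz : 0 < ∑ i, pderiv i u x ^ 2)
    (heq : ∀ᶠ y in 𝓝 x, elaplacian u y + ‖gradient u y‖ ^ q * u y ^ p = 0)
    (hmax : IsLocalMax (fun y => u y ^ (p - 1) * ‖gradient u y‖ ^ q * φ y ^ 2) x) {S : ℝ}
    (hS : ‖gradient u x‖ ^ 2 / u x ^ 2 ≤ S) (hφS : (∑ i, pderiv i φ x ^ 2) / φ x ^ 2 ≤ 4 * S)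
    (hΔS : -elaplacian φ x / φ x ≤ 2 * n * S) (hn : 0 < n) :
    u x ^ (p - 1) * ‖gradient u x‖ ^ q
      ≤ controlConstant n (2 * (p - 1) / q) (4 / q) * S := by
  set γ := 2 * (p - 1) / q with hγ
  set α := 4 / q with hα
  set F := u x ^ (p - 1) * ‖gradient u x‖ ^ q with hF
  have hud : DifferentiableAt ℝ u x := hu.differentiableAt (by simp)
  have hφd : DifferentiableAt ℝ φ x := hφ.differentiableAt (by simp)
  have hzd := (contDiffAt_sum_pderiv_sq hu).differentiableAt (by simp)
  have hlogmax : IsLocalMax (fun y => Real.log (∑ i, pderiv i u y ^ 2) + γ * Real.log (u y)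
      + α * Real.log (φ y)) x := by
    have hpos : ∀ᶠ y in 𝓝 x, 0 < u y ∧ 0 < φ y ∧ 0 < ∑ i, pderiv i u y ^ 2 :=
      (hud.continuousAt.eventually (lt_mem_nhds hu0)).and
        ((hφd.continuousAt.eventually (lt_mem_nhds hφ0)).and
          (hzd.continuousAt.eventually (lt_mem_nhds hz)))
    have hform : ∀ y, (0 < u y ∧ 0 < φ y ∧ 0 < ∑ i, pderiv i u y ^ 2) →
        Real.log (u y ^ (p - 1) * ‖gradient u y‖ ^ q * φ y ^ 2) = q / 2 *
          (Real.log (∑ i, pderiv i u y ^ 2) + γ * Real.log (u y) + α * Real.log (φ y)) := by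
      rintro y ⟨h1, h2, h3⟩
      rw [norm_gradient_rpow, Real.log_mul (by positivity) (by positivity),
        Real.log_mul (by positivity) (by positivity), Real.log_rpow h1, Real.log_rpow h3,
        Real.log_pow, hγ, hα]
      field_simp
      push_cast
      ring
    filter_upwards [hpos, hmax] with y hy hle
    have hlt : 0 < u y ^ (p - 1) * ‖gradient u y‖ ^ q * φ y ^ 2 := by
      obtain ⟨h1, h2, h3⟩ := hy
      rw [norm_gradient_rpow]
      positivity
    have := Real.log_le_log hlt hle
    rw [hform y hy, hform x hpos.self_of_nhds] at this
    exact le_of_mul_le_mul_left this (by positivity)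
  have hΔx : elaplacian u x = -(F * u x) := by
    have h := heq.self_of_nhds
    have : F * u x = ‖gradient u x‖ ^ q * u x ^ p := by
      rw [hF, mul_right_comm, mul_comm, ← Real.rpow_add_one hu0.ne', sub_add_cancel]
    linarith
  have hboch := bochner_at_isLocalMax hu hφ (contDiffAt_elaplacian_of_equation hu hu0 hz heq)
    hu0.ne' hφ0.ne' hz.ne' hlogmax
  have hcrit : ∀ j, (∑ i, 2 * pderiv i u x * pderiv j (pderiv i u) x) / (∑ i, pderiv i u x ^ 2)
      + γ * (pderiv j u x / u x) + α * (pderiv j φ x / φ x) = 0 := by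
    intro j
    have h := hlogmax.pderiv_eq_zero j
    rwa [pderiv_add j (f := fun y => Real.log (∑ i, pderiv i u y ^ 2) + γ * Real.log (u y))
      ((hzd.log hz.ne').add ((hud.log hu0.ne').const_mul _))
      ((hφd.log hφ0.ne').const_mul _), pderiv_add j (hzd.log hz.ne')
      ((hud.log hu0.ne').const_mul _), pderiv_const_mul j _ (hud.log hu0.ne'),
      pderiv_const_mul j _ (hφd.log hφ0.ne'), pderiv_log j hzd hz.ne', pderiv_log j hud hu0.ne',
      pderiv_log j hφd hφ0.ne', pderiv_sum_sq _ j fun i _ => hu.differentiableAt_pderiv i] at h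
  have hbern := bernstein_inequality hn hu0 hφ0 hz rfl
    (show q * γ = 2 * (p - 1) by rw [hγ]; field_simp) (show q * α = 4 by rw [hα]; field_simp)
    (by rw [← hΔx, elaplacian_eq_sum_pderiv]) hcrit
    (fun j => by rw [pderiv_elaplacian_of_equation hu hu0 hz heq j, hΔx]) (hΔx ▸ hboch)
  rw [norm_gradient_sq] at hS
  refine le_controlConstant_mul (by exact_mod_cast hn) (by positivity) (by positivity)
    (by positivity) hS ?_ (by positivity) hφS hΔS hbern
  rw [div_pow, mul_pow, div_mul_div_comm]
  gcongr
  exact Finset.sum_mul_sq_le_sq_mul_sq _ _ _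

theorem control_at_center_of_pos (hn : 0 < n) (hq : 0 < q) (hR : 0 < R)
    (hu : ∀ y ∈ Metric.closedBall c R, ContDiffAt ℝ 2 u y)
    (hu0 : ∀ y ∈ Metric.closedBall c R, 0 < u y)
    (heq : ∀ y ∈ Metric.closedBall c R, elaplacian u y + ‖gradient u y‖ ^ q * u y ^ p = 0)
    (hM : ∀ y ∈ Metric.closedBall c R, ‖gradient u y‖ ^ 2 / u y ^ 2 ≤ M) :
    u c ^ (p - 1) * ‖gradient u c‖ ^ q
      ≤ controlConstant n (2 * (p - 1) / q) (4 / q) * (M + 1 / R ^ 2) := by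
  have hcmem : c ∈ Metric.closedBall c R := Metric.mem_closedBall_self hR.le
  have hM0 : 0 ≤ M := le_trans (by positivity) (hM c hcmem)
  have hK : 0 ≤ controlConstant n (2 * (p - 1) / q) (4 / q) :=
    zero_le_one.trans (one_le_controlConstant (by positivity) (by positivity))
  have hFc : 0 ≤ u c ^ (p - 1) * ‖gradient u c‖ ^ q := by
    have := hu0 c hcmem
    positivity
  rcases hFc.eq_or_lt with h0 | hFc
  · rw [← h0]
    positivity
  set φ : EuclideanSpace ℝ (Fin n) → ℝ := fun y => 1 - (R ^ 2)⁻¹ * ‖y - c‖ ^ 2 with hφ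
  have hquad : ∀ y, ContDiffAt ℝ 2 (fun y : EuclideanSpace ℝ (Fin n) => ‖y - c‖ ^ 2) y := fun y =>
    (contDiffAt_id.sub contDiffAt_const).norm_sq ℝ
  have hφs : ∀ y, ContDiffAt ℝ 2 φ y := fun y =>
    contDiffAt_const.sub (contDiffAt_const.mul (hquad y))
  have hφc : φ c = 1 := by simp [hφ]
  have hcont : ContinuousOn (fun y => u y ^ (p - 1) * ‖gradient u y‖ ^ q * φ y ^ 2)
      (Metric.closedBall c R) := by
    intro y hy
    refine ContinuousAt.continuousWithinAt ?_
    simp only [norm_gradient_rpow]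
    exact (((hu y hy).continuousAt.rpow_const (Or.inl (hu0 y hy).ne')).mul
      ((contDiffAt_sum_pderiv_sq (hu y hy)).continuousAt.rpow_const
        (Or.inr (by positivity)))).mul ((hφs y).continuousAt.pow 2)
  obtain ⟨x, hx, hxmax⟩ := (isCompact_closedBall c R).exists_isMaxOn ⟨c, hcmem⟩ hcont
  have hle : u c ^ (p - 1) * ‖gradient u c‖ ^ q
      ≤ u x ^ (p - 1) * ‖gradient u x‖ ^ q * φ x ^ 2 := by
    have : u c ^ (p - 1) * ‖gradient u c‖ ^ q * φ c ^ 2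
      ≤ u x ^ (p - 1) * ‖gradient u x‖ ^ q * φ x ^ 2 := hxmax hcmem
    simpa [hφc] using this
  have hpos := hFc.trans_le hle
  have hux := hu0 x hx
  have hxR : ‖x - c‖ ≤ R := mem_closedBall_iff_norm.1 hx
  have hφne : φ x ≠ 0 := by
    rintro h
    simp [h] at hpos
  have hφ0 : 0 < φ x := by
    refine lt_of_le_of_ne ?_ hφne.symm
    have : ‖x - c‖ ^ 2 ≤ R ^ 2 := by gcongr
    rw [hφ, sub_nonneg, inv_mul_le_iff₀ (by positivity), mul_one]
    exact this
  have hxball : x ∈ Metric.ball c R := by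
    refine mem_ball_iff_norm.2 (lt_of_le_of_ne hxR fun h => hφne ?_)
    simp [hφ, h, hR.ne']
  have hnhds : Metric.closedBall c R ∈ 𝓝 x := Metric.closedBall_mem_nhds_of_mem hxball
  have hz : 0 < ∑ i, pderiv i u x ^ 2 := by
    rw [← norm_gradient_sq]
    have : ‖gradient u x‖ ≠ 0 := by
      intro h
      simp [h, Real.zero_rpow hq.ne'] at hpos
    positivity
  have hφ1 : φ x ≤ 1 := sub_le_self _ (by positivity)
  have hpφ : ∀ i, pderiv i φ x = -((R ^ 2)⁻¹ * (2 * (x i - c i))) := by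
    intro i
    have hd := (hquad x).differentiableAt (by simp)
    rw [hφ, pderiv_sub i (differentiableAt_const _) (hd.const_mul _), pderiv_const,
      pderiv_const_mul i _ hd, pderiv_normSq, zero_sub]
  have hΔφ : elaplacian φ x = -((R ^ 2)⁻¹ * (2 * n)) := by
    have h1 : elaplacian (fun _ : EuclideanSpace ℝ (Fin n) => (1 : ℝ)) x = 0 := by
      simp [elaplacian]
    rw [hφ, elaplacian_sub contDiffAt_const (contDiffAt_const.mul (hquad x)),
      elaplacian_const_mul _ (hquad x), elaplacian_normSq, h1, zero_sub]
  have hsum : ∑ i, pderiv i φ x ^ 2 = 4 * ‖x - c‖ ^ 2 / R ^ 4 := by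
    simp only [hpφ, EuclideanSpace.norm_sq_eq, PiLp.sub_apply, Real.norm_eq_abs, sq_abs,
      Finset.mul_sum, Finset.sum_div]
    refine Finset.sum_congr rfl fun i _ => ?_
    field_simp
    ring
  have hmain : u x ^ (p - 1) * ‖gradient u x‖ ^ q
      ≤ controlConstant n (2 * (p - 1) / q) (4 / q) * (M + 1 / (R ^ 2 * φ x ^ 2)) := by
    refine control_at_isLocalMax hq (hu x hx) (hφs x) hux hφ0 hz
      (eventually_of_mem hnhds heq) (hxmax.isLocalMax hnhds) ?_ ?_ ?_ hn
    · exact (hM x hx).trans (le_add_of_nonneg_right (by positivity))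
    · have : 4 * ‖x - c‖ ^ 2 / R ^ 4 ≤ 4 * R ^ 2 / R ^ 4 := by gcongr
      calc (∑ i, pderiv i φ x ^ 2) / φ x ^ 2 ≤ 4 * R ^ 2 / R ^ 4 / φ x ^ 2 := by
            rw [hsum]
            gcongr
        _ = 4 * (1 / (R ^ 2 * φ x ^ 2)) := by field_simp
        _ ≤ _ := by linarith
    · have : φ x ^ 2 ≤ φ x := by nlinarith
      calc -elaplacian φ x / φ x = 2 * n * (1 / (R ^ 2 * φ x)) := by
            rw [hΔφ]
            field_simp
        _ ≤ 2 * n * (M + 1 / (R ^ 2 * φ x ^ 2)) := by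
            gcongr
            exact le_add_of_nonneg_of_le hM0 (by gcongr)
  calc u c ^ (p - 1) * ‖gradient u c‖ ^ q
      ≤ u x ^ (p - 1) * ‖gradient u x‖ ^ q * φ x ^ 2 := hle
    _ ≤ controlConstant n (2 * (p - 1) / q) (4 / q) * (M + 1 / (R ^ 2 * φ x ^ 2)) * φ x ^ 2 := by
        gcongr
    _ = controlConstant n (2 * (p - 1) / q) (4 / q) * (M * φ x ^ 2 + 1 / R ^ 2) := by
        field_simp
    _ ≤ controlConstant n (2 * (p - 1) / q) (4 / q) * (M + 1 / R ^ 2) := by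
        gcongr
        exact mul_le_of_le_one_right hM0 (pow_le_one₀ hφ0.le hφ1)

/-- The case `q = 0`, by comparison of `log u` with a paraboloid. -/
theorem control_at_center_of_zero (hn : 0 < n) (hR : 0 < R)
    (hu : ∀ y ∈ Metric.closedBall c R, ContDiffAt ℝ 2 u y)
    (hu0 : ∀ y ∈ Metric.closedBall c R, 0 < u y)
    (heq : ∀ y ∈ Metric.closedBall c R, elaplacian u y + u y ^ p = 0)
    (hM : ∀ y ∈ Metric.closedBall c R, ‖gradient u y‖ ^ 2 / u y ^ 2 ≤ M) :
    u c ^ (p - 1) ≤ Real.exp |p - 1| * (4 * n) * (M + 1 / R ^ 2) := by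
  have hn' : (0 : ℝ) < n := by exact_mod_cast hn
  have hcR : c ∈ Metric.closedBall c R := Metric.mem_closedBall_self hR.le
  have hM0 : 0 ≤ M := le_trans (by positivity) (hM c hcR)
  set m := √M with hm
  have hm0 : 0 ≤ m := Real.sqrt_nonneg _
  have hmM : m ^ 2 = M := Real.sq_sqrt hM0
  set r := R / (1 + m * R) with hr
  have hr0 : 0 < r := by positivity
  have hrR : r ≤ R := div_le_self hR.le (by linarith [mul_nonneg hm0 hR.le])
  have hmr : m * r ≤ 1 := by
    rw [hr, mul_div_assoc', div_le_one (by positivity)]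
    linarith
  have hsub : Metric.closedBall c r ⊆ Metric.closedBall c R :=
    Metric.closedBall_subset_closedBall hrR
  have hc : c ∈ Metric.closedBall c r := Metric.mem_closedBall_self hr0.le
  have hlip : ∀ y ∈ Metric.closedBall c r, |Real.log (u y) - Real.log (u c)| ≤ m * r := by
    intro y hy
    have hd : ∀ z ∈ Metric.closedBall c r, DifferentiableAt ℝ u z := fun z hz =>
      (hu z (hsub hz)).differentiableAt (by simp)
    have hbound : ∀ z ∈ Metric.closedBall c r, ‖fderiv ℝ (fun z => Real.log (u z)) z‖ ≤ m := by
      intro z hz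
      have hz0 := hu0 z (hsub hz)
      have hgrad : ‖fderiv ℝ u z‖ = ‖gradient u z‖ := by
        rw [gradient, LinearIsometryEquiv.norm_map]
      rw [fderiv.log (hd z hz) hz0.ne', norm_smul, norm_inv, Real.norm_of_nonneg hz0.le, hgrad]
      refine Real.le_sqrt_of_sq_le ?_
      have := hM z (hsub hz)
      rwa [mul_pow, inv_pow, inv_mul_eq_div]
    have h := (convex_closedBall c r).norm_image_sub_le_of_norm_fderiv_le
      (fun z hz => (hd z hz).log (hu0 z (hsub hz)).ne') hbound hc hy
    rw [Real.norm_eq_abs] at h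
    refine h.trans ?_
    gcongr
    exact mem_closedBall_iff_norm.1 hy
  set lam := Real.exp (-|p - 1|) * u c ^ (p - 1) with hlam
  have hlam_le : ∀ y ∈ Metric.closedBall c r, lam ≤ u y ^ (p - 1) := by
    intro y hy
    have hy0 := hu0 y (hsub hy)
    have hc0 := hu0 c hcR
    rw [hlam, Real.rpow_def_of_pos hy0, Real.rpow_def_of_pos hc0, ← Real.exp_add]
    gcongr
    have h1 : |(Real.log (u c) - Real.log (u y)) * (p - 1)| ≤ 1 * |p - 1| := by
      rw [abs_mul, abs_sub_comm]
      gcongr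
      exact (hlip y hy).trans hmr
    have := (abs_le.1 h1).2
    linarith
  have hδ : ∀ δ, 2 * n * δ < lam → δ * r ^ 2 ≤ m * r := by
    intro δ hδ
    have hs : ∀ y ∈ Metric.closedBall c r,
        ContDiffAt ℝ 2 (fun y => (-1) * Real.log (u y)) y := fun y hy =>
      contDiffAt_const.mul ((hu y (hsub hy)).log (hu0 y (hsub hy)).ne')
    have hcont : ContinuousOn (fun y => (-1) * Real.log (u y) - δ * ‖y - c‖ ^ 2)
        (Metric.closedBall c r) := fun y hy =>
      ((hs y hy).continuousAt.sub (by fun_prop)).continuousWithinAt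
    obtain ⟨x, hx, hxmax⟩ := (isCompact_closedBall c r).exists_isMaxOn ⟨c, hc⟩ hcont
    have hux := hu0 x (hsub hx)
    have hxr : ‖x - c‖ = r := by
      refine le_antisymm (mem_closedBall_iff_norm.1 hx) (not_lt.1 fun hlt => ?_)
      have hmax := hxmax.isLocalMax
        (Metric.closedBall_mem_nhds_of_mem (mem_ball_iff_norm.2 hlt))
      have h1 := elaplacian_le_of_isLocalMax_sub (hs x hx) hmax
      have hux2 := hu x (hsub hx)
      rw [elaplacian_const_mul _ (hux2.log hux.ne'), elaplacian_log hux2 hux.ne'] at h1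
      have h2 : elaplacian u x / u x = -(u x ^ (p - 1)) := by
        rw [Real.rpow_sub_one hux.ne', ← neg_div]
        congr 1
        linarith [heq x (hsub hx)]
      have h3 : 0 ≤ (∑ i, pderiv i u x ^ 2) / u x ^ 2 := by positivity
      linarith [hlam_le x hx]
    have h1 : (-1) * Real.log (u c) - δ * ‖c - c‖ ^ 2
        ≤ (-1) * Real.log (u x) - δ * ‖x - c‖ ^ 2 := hxmax hc
    rw [hxr, sub_self, norm_zero] at h1
    have h2 := (abs_le.1 (hlip x hx)).1
    linarith
  have hlamr : lam ≤ 2 * n * (m / r) := by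
    by_contra! hlt
    obtain ⟨t, ht1, ht2⟩ := exists_between hlt
    have h := hδ (t / (2 * n)) (by rwa [mul_div_cancel₀ _ (by positivity)])
    have : t ≤ 2 * n * (m / r) := by
      rw [div_mul_eq_mul_div, div_le_iff₀ (by positivity)] at h
      rw [mul_div_assoc', le_div_iff₀ hr0]
      nlinarith
    linarith
  have hmr' : m / r ≤ 2 * (M + 1 / R ^ 2) := by
    have h1 : m / r = m * (1 / R) + m ^ 2 := by
      rw [hr]
      field_simp
    have h2 : (1 / R) ^ 2 = 1 / R ^ 2 := by rw [div_pow, one_pow]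
    rw [h1, ← h2, ← hmM]
    nlinarith [sq_nonneg (m - 1 / R), sq_nonneg m, sq_nonneg (1 / R)]
  calc u c ^ (p - 1) = Real.exp |p - 1| * lam := by
        rw [hlam, ← mul_assoc, ← Real.exp_add, add_neg_cancel, Real.exp_zero, one_mul]
    _ ≤ Real.exp |p - 1| * (2 * n * (2 * (M + 1 / R ^ 2))) := by
        gcongr
        exact hlamr.trans (by gcongr)
    _ = Real.exp |p - 1| * (4 * n) * (M + 1 / R ^ 2) := by ring

end CenterEstimate

/-- **Lemma 7.2 (Euclidean case, second mutual control lemma).** For `n ≥ 2`, `q ≥ 0` and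
`p ∈ ℝ`, there is `C = C(n,p,q) > 0` such that every positive classical solution of
`Δu + |∇u|^q u^p = 0` on `B(x₀, 2R)` satisfies
`sup_(B(x₀,R)) u^(p−1)|∇u|^q ≤ C (sup_(B(x₀,2R)) |∇u|²/u² + 1/R²)`, expressed via an
arbitrary upper bound `M` of `|∇u|²/u²` on `B(x₀,2R)`. -/
theorem mutual_control_second (n : ℕ) (hn : 2 ≤ n) (p q : ℝ) (hq : 0 ≤ q) :
    ∃ C > (0 : ℝ), ∀ (x₀ : EuclideanSpace ℝ (Fin n)) (R : ℝ), 0 < R →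
      ∀ u : EuclideanSpace ℝ (Fin n) → ℝ,
        ContDiffOn ℝ 2 u (Metric.ball x₀ (2 * R)) →
        (∀ x ∈ Metric.ball x₀ (2 * R), 0 < u x) →
        (∀ x ∈ Metric.ball x₀ (2 * R),
          elaplacian u x + ‖gradient u x‖ ^ q * u x ^ p = 0) →
        ∀ M : ℝ, (∀ y ∈ Metric.ball x₀ (2 * R), ‖gradient u y‖ ^ 2 / u y ^ 2 ≤ M) →
        ∀ x ∈ Metric.ball x₀ R,
          u x ^ (p - 1) * ‖gradient u x‖ ^ q ≤ C * (M + 1 / R ^ 2) := by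
  have hn0 : 0 < n := by omega
  have hsub : ∀ (x₀ : EuclideanSpace ℝ (Fin n)) (R : ℝ), ∀ x ∈ Metric.ball x₀ R,
      Metric.closedBall x R ⊆ Metric.ball x₀ (2 * R) := fun x₀ R x hx =>
    Metric.closedBall_subset_ball' (by linarith [Metric.mem_ball.1 hx])
  rcases hq.eq_or_lt with rfl | hq
  · refine ⟨Real.exp |p - 1| * (4 * n), by positivity, ?_⟩
    intro x₀ R hR u hu hu0 heq M hM x hx
    have hs := hsub x₀ R x hx
    rw [Real.rpow_zero, mul_one]
    exact control_at_center_of_zero hn0 hR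
      (fun y hy => hu.contDiffAt (Metric.isOpen_ball.mem_nhds (hs hy)))
      (fun y hy => hu0 y (hs hy)) (fun y hy => by simpa using heq y (hs hy))
      (fun y hy => hM y (hs hy))
  · refine ⟨controlConstant n (2 * (p - 1) / q) (4 / q),
      zero_lt_one.trans_le (one_le_controlConstant (by positivity) (by positivity)), ?_⟩
    intro x₀ R hR u hu hu0 heq M hM x hx
    have hs := hsub x₀ R x hx
    exact control_at_center_of_pos hn0 hq hR
      (fun y hy => hu.contDiffAt (Metric.isOpen_ball.mem_nhds (hs hy)))
      (fun y hy => hu0 y (hs hy)) (fun y hy => heq y (hs hy)) (fun y hy => hM y (hs hy))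
end
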